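/- arXiv:1511.01315 — 9 statements merged into one kernel-verified Lean document; each statement's English description precedes it below -/
import Mathlib

section
/- Let k, d, λ ≥ 1 be integers with d ≥ λ and k ≥ λ+1, and suppose α(d,λ) < 1 (the non-trivial range). Then m*(k,d,λ) ≥ (d−λ+1)+k; in particular, every set of (d−λ+1)+k points in ℝ^d (not necessarily in general position) has a complete Kneser (d−λ)-transversal with respect to k. -/
open Finset

noncomputable section

/-- Points of `ℝ^d`. -/
abbrev Pt (d : ℕ) : Type := Fin d → ℝ

/-- `L` is a complete Kneser `(d-λ)`-transversal of the finite point set `X` with respect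
to `k`: it is an affine subspace of dimension `d - λ` containing at least `(d-λ)+1` points
of `X` and intersecting the convex hull of every `k`-element subset of `X`. -/
def IsCompleteKneserTransversal (k d lam : ℕ) (X : Finset (Pt d))
    (L : AffineSubspace ℝ (Pt d)) : Prop :=
  Module.finrank ℝ L.direction = d - lam ∧
  (∃ T : Finset (Pt d), T ⊆ X ∧ T.card = d - lam + 1 ∧ (T : Set (Pt d)) ⊆ (L : Set (Pt d))) ∧
  ∀ Y : Finset (Pt d), Y ⊆ X → Y.card = k →
    ((convexHull ℝ (Y : Set (Pt d))) ∩ (L : Set (Pt d))).Nonempty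

/-- `X` has a complete Kneser `(d-λ)`-transversal with respect to `k`. -/
def HasCKT (k d lam : ℕ) (X : Finset (Pt d)) : Prop :=
  ∃ L : AffineSubspace ℝ (Pt d), IsCompleteKneserTransversal k d lam X L

/-- The set of positive integers `n` such that every set of `n` points in `ℝ^d` has a
complete Kneser `(d-λ)`-transversal with respect to `k`.  `m*(k,d,λ)` is the maximum of
this set. -/
def mStarSet (k d lam : ℕ) : Set ℕ :=
  {n | 0 < n ∧ ∀ X : Finset (Pt d), X.card = n → HasCKT k d lam X}

/-- `α(d,λ) = (λ-1)/⌈d/2⌉` (note `⌈d/2⌉ = (d+1)/2` as naturals). -/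
def alphaVal (d lam : ℕ) : ℝ := ((lam : ℝ) - 1) / (((d + 1) / 2 : ℕ) : ℝ)

open Module

/-- A subspace of a finite-dimensional space is contained in subspaces of every intermediate
dimension. -/
theorem Submodule.exists_ge_finrank_eq {K V : Type*} [DivisionRing K] [AddCommGroup V] [Module K V]
    [FiniteDimensional K V] (W : Submodule K V) {n : ℕ} (hW : finrank K W ≤ n)
    (hn : n ≤ finrank K V) : ∃ W' : Submodule K V, W ≤ W' ∧ finrank K W' = n := by
  induction n, hW using Nat.le_induction with
  | base => exact ⟨W, le_rfl, rfl⟩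
  | succ n _ ih =>
    obtain ⟨W', hle, hrank⟩ := ih (by omega)
    have hne : W' < ⊤ := by
      rw [lt_top_iff_ne_top]
      rintro rfl
      rw [finrank_top] at hrank
      omega
    obtain ⟨v, -, hv⟩ := SetLike.exists_of_lt hne
    refine ⟨W' ⊔ K ∙ v, hle.trans le_sup_left, ?_⟩
    have hlt : W' < W' ⊔ K ∙ v := by
      refine lt_of_le_of_ne le_sup_left fun h => hv ?_
      rw [h]
      exact Submodule.mem_sup_right (Submodule.mem_span_singleton_self v)
    have h1 := Submodule.finrank_lt_finrank_of_lt hlt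
    have h2 := Submodule.finrank_add_le_finrank_add_finrank W' (K ∙ v)
    have h3 := finrank_span_singleton (K := K) (v := v) (by rintro rfl; exact hv W'.zero_mem)
    omega

/-- A finite set of `n + 1` points lies on an affine subspace of dimension exactly `n`. -/
theorem AffineSubspace.exists_finrank_direction_eq_of_card {K V : Type*} [DivisionRing K]
    [AddCommGroup V] [Module K V] [FiniteDimensional K V] {T : Finset V} {n : ℕ}
    (hT : T.card = n + 1) (hn : n ≤ finrank K V) :
    ∃ L : AffineSubspace K V, finrank K L.direction = n ∧ (T : Set V) ⊆ L := by
  classical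
  obtain ⟨p, hp⟩ : T.Nonempty := card_pos.1 (by omega)
  have hrank : finrank K (vectorSpan K (T : Set V)) ≤ n := by
    have h := finrank_vectorSpan_image_finset_le K (id : V → V) T hT
    rwa [image_id] at h
  obtain ⟨W, hW, hWn⟩ := Submodule.exists_ge_finrank_eq _ hrank hn
  refine ⟨AffineSubspace.mk' p W, by rw [AffineSubspace.direction_mk', hWn], fun x hx => ?_⟩
  rw [SetLike.mem_coe, AffineSubspace.mem_mk']
  exact hW (vsub_mem_vectorSpan K hx hp)

/-- If the positive-weight points of an affine dependency on `X` are not all in `T`, while all the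
negative-weight points are, then every affine subspace through `T` meets the convex hull of
`X \ T`. -/
theorem convexHull_sdiff_inter_nonempty {𝕜 V : Type*} [Field 𝕜] [LinearOrder 𝕜]
    [IsStrictOrderedRing 𝕜] [AddCommGroup V] [Module 𝕜 V] [DecidableEq V] {X T : Finset V}
    (hTX : T ⊆ X) (hT : T.Nonempty) {w : V → 𝕜} (hw : ∑ x ∈ X, w x • x = 0)
    (hw0 : ∑ x ∈ X, w x = 0) (hneg : ∀ x ∈ X, w x < 0 → x ∈ T)
    (hpos : ∃ x ∈ X, 0 < w x ∧ x ∉ T) {L : AffineSubspace 𝕜 V} (hL : (T : Set V) ⊆ L) :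
    (convexHull 𝕜 ((X \ T : Finset V) : Set V) ∩ (L : Set V)).Nonempty := by
  obtain ⟨p, hp⟩ := hT
  have hnn : ∀ x ∈ X \ T, 0 ≤ w x := fun x hx =>
    not_lt.1 fun h => (mem_sdiff.1 hx).2 (hneg x (mem_sdiff.1 hx).1 h)
  have hs : 0 < ∑ x ∈ X \ T, w x := by
    obtain ⟨x, hx, hxw, hxT⟩ := hpos
    exact sum_pos' hnn ⟨x, mem_sdiff.2 ⟨hx, hxT⟩, hxw⟩
  refine ⟨(X \ T).centerMass w id, centerMass_id_mem_convexHull _ hnn hs, ?_⟩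
  rw [← sum_sdiff hTX] at hw hw0
  rw [SetLike.mem_coe, ← AffineSubspace.vsub_right_mem_direction_iff_mem (hL hp)]
  have key : (X \ T).centerMass w id -ᵥ p =
      (∑ x ∈ X \ T, w x)⁻¹ • ∑ x ∈ T, (-w x) • (x -ᵥ p) := by
    have h1 : ∑ x ∈ X \ T, w x • x = -∑ x ∈ T, w x • x := eq_neg_of_add_eq_zero_left hw
    have h2 : ∑ x ∈ T, w x = -∑ x ∈ X \ T, w x := eq_neg_of_add_eq_zero_right hw0
    simp only [centerMass, id, vsub_eq_sub, smul_sub, sum_sub_distrib, ← sum_smul, neg_smul,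
      sum_neg_distrib, h1, h2, neg_neg, inv_smul_smul₀ hs.ne']
  rw [key]
  exact L.direction.smul_mem _ (L.direction.sum_mem fun x hx =>
    L.direction.smul_mem _ (AffineSubspace.vsub_mem_direction (hL hx) (hL hp)))

/-- More than `finrank 𝕜 V + 1` points admit a nontrivial affine dependency with at most half of
`finrank 𝕜 V + 2` negative weights. -/
theorem exists_affine_dependency_card_neg_le {𝕜 V : Type*} [Field 𝕜] [LinearOrder 𝕜]
    [IsStrictOrderedRing 𝕜] [AddCommGroup V] [Module 𝕜 V] [FiniteDimensional 𝕜 V] {X : Finset V}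
    (hX : finrank 𝕜 V + 2 ≤ X.card) :
    ∃ w : V → 𝕜, ∑ x ∈ X, w x • x = 0 ∧ ∑ x ∈ X, w x = 0 ∧ (∃ x ∈ X, 0 < w x) ∧
      (X.filter (w · < 0)).card ≤ (finrank 𝕜 V + 2) / 2 := by
  classical
  obtain ⟨U, hUX, hU⟩ := exists_subset_card_eq hX
  obtain ⟨f, hf, hf0, hne⟩ :=
    exists_nontrivial_relation_sum_zero_of_finrank_succ_lt_card (R := 𝕜) (t := U) (by omega)
  have main : ∀ g : V → 𝕜, ∑ x ∈ U, g x • x = 0 → ∑ x ∈ U, g x = 0 → (∃ x ∈ U, g x ≠ 0) →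
      (U.filter (g · < 0)).card ≤ (finrank 𝕜 V + 2) / 2 →
      ∃ w : V → 𝕜, ∑ x ∈ X, w x • x = 0 ∧ ∑ x ∈ X, w x = 0 ∧ (∃ x ∈ X, 0 < w x) ∧
        (X.filter (w · < 0)).card ≤ (finrank 𝕜 V + 2) / 2 := by
    intro g hg hg0 hgne hcard
    obtain ⟨x, hx, hxpos⟩ := exists_pos_of_sum_zero_of_exists_nonzero g hg0 hgne
    refine ⟨fun x => if x ∈ U then g x else 0, ?_, ?_, ⟨x, hUX hx, by simpa [hx]⟩,
      (card_le_card fun y hy => ?_).trans hcard⟩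
    · simpa [ite_smul, ← sum_filter, filter_mem_eq_inter, inter_eq_right.2 hUX] using hg
    · simpa [← sum_filter, filter_mem_eq_inter, inter_eq_right.2 hUX] using hg0
    · by_cases hyU : y ∈ U <;> simp_all
  have hdisj : Disjoint (U.filter (f · < 0)) (U.filter (-f · < 0)) :=
    disjoint_filter.2 fun x _ h1 h2 => by linarith
  have hle : (U.filter (f · < 0)).card + (U.filter (-f · < 0)).card ≤ U.card := by
    rw [← card_union_of_disjoint hdisj]
    exact card_le_card (union_subset (filter_subset _ _) (filter_subset _ _))
  by_cases h : (U.filter (f · < 0)).card ≤ (finrank 𝕜 V + 2) / 2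
  · exact main f hf hf0 hne h
  · exact main (fun x => -f x) (by simpa using hf) (by simpa using hf0) (by simpa using hne)
      (by omega)

/-- in the non-trivial range `α(d,λ) < 1`, one has
`m*(k,d,λ) ≥ (d-λ+1)+k`; that is, every set of `(d-λ+1)+k` points of `ℝ^d` has a
complete Kneser `(d-λ)`-transversal with respect to `k`. -/
theorem mStar_lower_bound (k d lam : ℕ) (hk : 1 ≤ k) (hd : 1 ≤ d) (hlam : 1 ≤ lam)
    (hdl : lam ≤ d) (hkl : lam + 1 ≤ k) (hα : alphaVal d lam < 1) :
    (d - lam + 1) + k ∈ mStarSet k d lam := by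
  classical
  refine ⟨by omega, fun X hX => ?_⟩
  have hhalf : lam ≤ (d + 1) / 2 := by
    have hpos : (0 : ℝ) < ((d + 1) / 2 : ℕ) := by
      have : 0 < (d + 1) / 2 := by omega
      exact_mod_cast this
    rw [alphaVal, div_lt_one hpos, sub_lt_iff_lt_add] at hα
    exact Nat.lt_succ_iff.1 (by exact_mod_cast hα)
  have hrank : finrank ℝ (Pt d) = d := by simp
  obtain ⟨w, hw, hw0, ⟨p, hp, hpw⟩, hcard⟩ :=
    exists_affine_dependency_card_neg_le (𝕜 := ℝ) (X := X) (by omega)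
  have hsub : X.filter (w · < 0) ⊆ X.erase p := fun x hx => by
    rw [mem_filter] at hx
    refine mem_erase.2 ⟨?_, hx.1⟩
    rintro rfl
    exact lt_asymm hx.2 hpw
  obtain ⟨T, hnegT, hTX, hT⟩ := exists_subsuperset_card_eq (n := d - lam + 1) hsub (by omega)
    (by rw [card_erase_of_mem hp]; omega)
  have hTX' : T ⊆ X := hTX.trans (erase_subset _ _)
  obtain ⟨L, hLrank, hTL⟩ :=
    AffineSubspace.exists_finrank_direction_eq_of_card (K := ℝ) hT (by omega)
  refine ⟨L, hLrank, ⟨T, hTX', hT, hTL⟩, fun Y hYX hY => ?_⟩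
  by_cases hYT : Disjoint Y T
  · have hYeq : Y = X \ T := by
      refine eq_of_subset_of_card_le (subset_sdiff.2 ⟨hYX, hYT⟩) ?_
      rw [card_sdiff_of_subset hTX']
      omega
    rw [hYeq]
    exact convexHull_sdiff_inter_nonempty hTX' (card_pos.1 (by omega)) hw hw0
      (fun x hx hxw => hnegT (mem_filter.2 ⟨hx, hxw⟩))
      ⟨p, hp, hpw, fun h => (mem_erase.1 (hTX h)).1 rfl⟩ hTL
  · obtain ⟨x, hxY, hxT⟩ := not_disjoint_iff.1 hYT
    exact ⟨x, subset_convexHull ℝ _ hxY, hTL hxT⟩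
end
end

section
/- Let k, d, λ ≥ 1 be integers with d ≥ λ and k ≥ λ+1, and suppose α(d,λ) ≥ 1 (the trivial range). Then m*(k,d,λ) = ζ(k,d,λ) = d−λ+k. -/
open Finset

noncomputable section

/-- The moment curve `γ(t) = (t, t², …, t^d)` in `ℝ^d`. -/
def momentCurve (d : ℕ) (t : ℝ) : Pt d := fun i => t ^ ((i : ℕ) + 1)

/-- The vertex set `{γ(t₁), …, γ(t_n)}` of a cyclic polytope. -/
def cyclicVerts (d n : ℕ) (t : Fin n → ℝ) : Finset (Pt d) :=
  Finset.image (fun i => momentCurve d (t i)) Finset.univ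

/-- The set of positive integers `n` such that for every choice of reals
`t₁ < … < t_n` the vertex set of the corresponding cyclic polytope in `ℝ^d` has a
complete Kneser `(d-λ)`-transversal with respect to `k`; `ζ(k,d,λ)` is its maximum. -/
def zetaSet (k d lam : ℕ) : Set ℕ :=
  {n | 0 < n ∧ ∀ t : Fin n → ℝ, StrictMono t → HasCKT k d lam (cyclicVerts d n t)}

/-- A subspace of a finite-dimensional space extends to one of any larger possible dimension. -/
lemma Submodule.exists_le_finrank_eq {K V : Type*} [DivisionRing K] [AddCommGroup V] [Module K V]
    [FiniteDimensional K V] {W : Submodule K V} {r : ℕ} (hW : Module.finrank K W ≤ r)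
    (hr : r ≤ Module.finrank K V) : ∃ U : Submodule K V, W ≤ U ∧ Module.finrank K U = r := by
  induction r, hW using Nat.le_induction with
  | base => exact ⟨W, le_rfl, rfl⟩
  | succ r _ ih =>
    obtain ⟨U, hWU, hU⟩ := ih (by omega)
    obtain ⟨v, -, hv⟩ := SetLike.exists_of_lt
      (Submodule.lt_top_of_finrank_lt_finrank (show Module.finrank K U < _ by omega))
    refine ⟨U ⊔ Submodule.span K {v}, hWU.trans le_sup_left, ?_⟩
    rw [Submodule.finrank_sup_span_singleton hv, hU]

/-- The affine functional on `ℝ^d` whose restriction to the moment curve is the polynomial `p`,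
as long as `p` has degree at most `d`. -/
def momentFunctional (d : ℕ) (p : Polynomial ℝ) : Pt d →ᵃ[ℝ] ℝ :=
  (∑ i : Fin d, p.coeff ((i : ℕ) + 1) • LinearMap.proj (R := ℝ) (φ := fun _ : Fin d => ℝ) i
    ).toAffineMap + AffineMap.const ℝ (Pt d) (p.coeff 0)

lemma momentFunctional_apply (d : ℕ) (p : Polynomial ℝ) (x : Pt d) :
    momentFunctional d p x = ∑ i : Fin d, p.coeff ((i : ℕ) + 1) * x i + p.coeff 0 := by
  simp [momentFunctional]

lemma momentFunctional_momentCurve {d : ℕ} {p : Polynomial ℝ} (hp : p.natDegree ≤ d) (t : ℝ) :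
    momentFunctional d p (momentCurve d t) = p.eval t := by
  rw [momentFunctional_apply, Polynomial.eval_eq_sum_range' (Nat.lt_succ_of_le hp),
    Finset.sum_range_succ', Finset.sum_range]
  simp [momentCurve]

lemma momentCurve_injective {d : ℕ} (hd : 1 ≤ d) : Function.Injective (momentCurve d) := by
  intro s t h
  simpa [momentCurve] using congrFun h ⟨0, hd⟩

/-- At most `d + 1` points on the moment curve are affinely independent. -/
lemma affineIndependent_momentCurve {d : ℕ} (S : Finset ℝ) (hS : S.card ≤ d + 1) :
    AffineIndependent ℝ (fun t : S => momentCurve d t) := by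
  rw [affineIndependent_iff]
  intro s w hw hsum j hj
  set q : Polynomial ℝ := Lagrange.nodal (S.erase j) id with hq
  have hdeg : q.natDegree ≤ d := by
    rw [hq, Lagrange.natDegree_nodal, Finset.card_erase_of_mem j.2]
    omega
  have hcoord (i : Fin d) : ∑ e ∈ s, w e * momentCurve d e i = 0 := by
    simpa using congrFun hsum i
  have hzero : ∑ e ∈ s, w e * q.eval (e : ℝ) = 0 := by
    simp_rw [← momentFunctional_momentCurve hdeg, momentFunctional_apply, mul_add,
      Finset.sum_add_distrib, ← Finset.sum_mul, hw, Finset.mul_sum]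
    rw [Finset.sum_comm, zero_mul, add_zero]
    refine Finset.sum_eq_zero fun i _ => ?_
    simp_rw [mul_left_comm (w _), ← Finset.mul_sum, hcoord, mul_zero]
  rw [Finset.sum_eq_single_of_mem j hj] at hzero
  · refine (mul_eq_zero.mp hzero).resolve_right ?_
    rw [hq, Lagrange.eval_nodal]
    refine Finset.prod_ne_zero_iff.mpr fun a ha => ?_
    exact sub_ne_zero.mpr (Finset.ne_of_mem_erase ha).symm
  · intro e _ hej
    have he : (e : ℝ) ∈ S.erase (j : ℝ) :=
      Finset.mem_erase.mpr ⟨fun h => hej (Subtype.ext h), e.2⟩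
    rw [hq, show q.eval (e : ℝ) = 0 from Lagrange.eval_nodal_at_node (v := id) he, mul_zero]

/-- A flat of dimension `r` containing `r + 1 ≤ d / 2 + 1` points of the moment curve misses the
convex hull of any set of other points of the curve. -/
lemma disjoint_convexHull_momentCurve {d r : ℕ} (hr : 2 * (r + 1) ≤ d)
    (L : AffineSubspace ℝ (Pt d)) (hL : Module.finrank ℝ L.direction = r)
    (S U : Finset ℝ) (hS : S.card = r + 1)
    (hSL : ∀ t ∈ S, momentCurve d t ∈ L) (hSU : Disjoint S U) :
    Disjoint (convexHull ℝ (momentCurve d '' (U : Set ℝ))) (L : Set (Pt d)) := by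
  set p : Polynomial ℝ := Lagrange.nodal S id ^ 2 with hp
  have hdeg : p.natDegree ≤ d := by
    rw [hp, Polynomial.natDegree_pow, Lagrange.natDegree_nodal, hS]
    omega
  have hspan : affineSpan ℝ (Set.range fun t : S => momentCurve d t) = L := by
    refine (affineIndependent_momentCurve S (by omega)
      ).affineSpan_eq_of_le_of_card_eq_finrank_add_one ?_ ?_
    · rw [affineSpan_le]
      rintro _ ⟨t, rfl⟩
      exact hSL t t.2
    · simp [hL, hS]
  have hvanish : L ≤ (affineSpan ℝ {(0 : ℝ)}).comap (momentFunctional d p) := by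
    rw [← hspan, affineSpan_le]
    rintro _ ⟨t, rfl⟩
    rw [SetLike.mem_coe, AffineSubspace.mem_comap, AffineSubspace.mem_affineSpan_singleton,
      momentFunctional_momentCurve hdeg, hp, Polynomial.eval_pow,
      show (Lagrange.nodal S id).eval (t : ℝ) = 0 from
        Lagrange.eval_nodal_at_node (v := id) t.2]
    simp
  have hpos : convexHull ℝ (momentCurve d '' (U : Set ℝ)) ⊆
      momentFunctional d p ⁻¹' Set.Ioi 0 := by
    refine convexHull_min ?_ ((convex_Ioi 0).affine_preimage _)
    rintro _ ⟨u, hu, rfl⟩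
    rw [Set.mem_preimage, Set.mem_Ioi, momentFunctional_momentCurve hdeg, hp,
      Polynomial.eval_pow]
    refine sq_pos_of_ne_zero ?_
    rw [Lagrange.eval_nodal, Finset.prod_ne_zero_iff]
    intro s hs hzero
    have hus : u = s := sub_eq_zero.mp hzero
    exact Finset.disjoint_left.mp hSU (hus ▸ hs) hu
  rw [Set.disjoint_left]
  intro x hx hxL
  have h0 := hvanish hxL
  rw [AffineSubspace.mem_comap, AffineSubspace.mem_affineSpan_singleton] at h0
  exact (hpos hx).ne' h0

/-- The vertices of a cyclic polytope in the trivial range have no transversal once there are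
`k` of them left outside the flat. -/
lemma not_hasCKT_cyclicVerts {k d lam n : ℕ} (hd : 1 ≤ d) (hdl : 2 * (d - lam + 1) ≤ d)
    (hn : d - lam + k < n) {t : Fin n → ℝ} (ht : StrictMono t) :
    ¬ HasCKT k d lam (cyclicVerts d n t) := by
  rintro ⟨L, hL, ⟨T, hTX, hTcard, hTL⟩, hconv⟩
  have hinj := momentCurve_injective hd
  set R : Finset ℝ := Finset.univ.image t with hR
  have hX : cyclicVerts d n t = R.image (momentCurve d) := by
    rw [hR, Finset.image_image]
    rfl
  have hRcard : R.card = n := by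
    rw [hR, Finset.card_image_of_injective _ ht.injective, Finset.card_univ, Fintype.card_fin]
  rw [hX] at hTX hconv
  obtain ⟨S, hSR, rfl⟩ := Finset.subset_image_iff.mp hTX
  rw [Finset.card_image_of_injective _ hinj] at hTcard
  have hk : k ≤ (R \ S).card := by
    rw [Finset.card_sdiff_of_subset hSR]
    omega
  obtain ⟨U, hU, hUcard⟩ := Finset.exists_subset_card_eq hk
  have hne := hconv (U.image (momentCurve d))
    (Finset.image_subset_image (hU.trans Finset.sdiff_subset))
    (by rw [Finset.card_image_of_injective _ hinj, hUcard])
  rw [Finset.coe_image] at hne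
  refine Set.not_disjoint_iff_nonempty_inter.mpr hne
    (disjoint_convexHull_momentCurve hdl L hL S U hTcard ?_ ?_)
  · intro s hs
    exact hTL (Finset.mem_coe.mpr (Finset.mem_image_of_mem _ hs))
  · exact Finset.disjoint_sdiff.mono_right hU

/-- Any `d - λ + k` points have a transversal: a flat through `d - λ + 1` of them leaves out at
most `k - 1` points. -/
lemma hasCKT_of_card {k d lam : ℕ} (hk : 1 ≤ k) {X : Finset (Pt d)}
    (hX : X.card = d - lam + k) : HasCKT k d lam X := by
  obtain ⟨T, hTX, hT⟩ := Finset.exists_subset_card_eq (show d - lam + 1 ≤ X.card by omega)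
  obtain ⟨x, hx⟩ := Finset.card_pos.mp (show 0 < T.card by omega)
  have hle : Module.finrank ℝ (vectorSpan ℝ (T : Set (Pt d))) ≤ d - lam := by
    have := finrank_vectorSpan_image_finset_le ℝ (id : Pt d → Pt d) T hT
    rwa [Finset.image_id] at this
  obtain ⟨V, hV, hVrank⟩ := Submodule.exists_le_finrank_eq hle
    (by simp : d - lam ≤ Module.finrank ℝ (Pt d))
  have hTL : (T : Set (Pt d)) ⊆ AffineSubspace.mk' x V := by
    intro y hy
    exact AffineSubspace.mem_mk'.mpr (hV (vsub_mem_vectorSpan ℝ hy hx))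
  refine ⟨AffineSubspace.mk' x V, by rw [AffineSubspace.direction_mk', hVrank],
    ⟨T, hTX, hT, hTL⟩, fun Y hYX hY => ?_⟩
  have hinter : (T ∩ Y).Nonempty := by
    refine Finset.inter_nonempty_of_card_lt_card_add_card hTX hYX ?_
    omega
  obtain ⟨y, hy⟩ := hinter
  rw [Finset.mem_inter] at hy
  exact ⟨y, subset_convexHull ℝ _ hy.2, hTL hy.1⟩

lemma mStarSet_subset_zetaSet {k d lam : ℕ} (hd : 1 ≤ d) :
    mStarSet k d lam ⊆ zetaSet k d lam := by
  refine fun n hn => ⟨hn.1, fun t ht => hn.2 _ ?_⟩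
  exact (Finset.card_image_of_injective _
    ((momentCurve_injective hd).comp ht.injective)).trans (Finset.card_fin n)

/-- in the trivial range `α(d,λ) ≥ 1`,
`m*(k,d,λ) = ζ(k,d,λ) = d - λ + k`. -/
theorem mStar_zeta_trivial_range (k d lam : ℕ) (hk : 1 ≤ k) (hd : 1 ≤ d) (hlam : 1 ≤ lam)
    (hdl : lam ≤ d) (hkl : lam + 1 ≤ k) (hα : 1 ≤ alphaVal d lam) :
    IsGreatest (mStarSet k d lam) (d - lam + k) ∧
    IsGreatest (zetaSet k d lam) (d - lam + k) := by
  have hdeg : 2 * (d - lam + 1) ≤ d := by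
    have hc : 0 < (d + 1) / 2 := by omega
    rw [alphaVal, le_div_iff₀ (by exact_mod_cast hc), one_mul, le_sub_iff_add_le] at hα
    have : (d + 1) / 2 + 1 ≤ lam := by exact_mod_cast hα
    omega
  have hmem : d - lam + k ∈ mStarSet k d lam :=
    ⟨by omega, fun X hX => hasCKT_of_card hk hX⟩
  have hub : d - lam + k ∈ upperBounds (zetaSet k d lam) := by
    intro n hn
    by_contra! hlt
    have ht : StrictMono fun i : Fin n => ((i : ℕ) : ℝ) := fun i j hij =>
      Nat.cast_lt.mpr hij
    exact not_hasCKT_cyclicVerts hd hdeg hlt ht (hn.2 _ ht)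
  have hsub := mStarSet_subset_zetaSet (k := k) (lam := lam) hd
  exact ⟨⟨hmem, fun n hn => hub (hsub hn)⟩, hsub hmem, hub⟩
end
end

section
/- Let k, d, λ ≥ 1 be integers with d ≥ λ, k ≥ λ+1, and α(d,λ) ≥ 1. Let n ≥ (d−λ+1)+k, let t₁ < t₂ < … < t_n be reals, and let V = {γ(t₁), …, γ(t_n)} ⊂ ℝ^d be the corresponding points on the moment curve. Then there is no subset T ⊆ V with |T| = d−λ+1 such that the affine hull of T intersects the convex hull of every k-element subset of V; that is, V has no complete Kneser (d−λ)-transversal with respect to k. -/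
open Finset

noncomputable section

theorem momentCurve_apply_zero {d : ℕ} (hd : 0 < d) (s : ℝ) :
    momentCurve d s ⟨0, hd⟩ = s := by
  simp [momentCurve]

theorem card_cyclicVerts {d n : ℕ} (hd : 0 < d) {t : Fin n → ℝ} (ht : StrictMono t) :
    (cyclicVerts d n t).card = n := by
  rw [cyclicVerts, Finset.card_image_of_injective, Finset.card_univ, Fintype.card_fin]
  intro i j hij
  apply ht.injective
  simpa only [momentCurve_apply_zero] using congrFun hij ⟨0, hd⟩

/-- The affine functional on `ℝ^d` whose coefficients are those of the polynomial `p`. -/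
def coeffFunctional (d : ℕ) (p : Polynomial ℝ) : Pt d →ᵃ[ℝ] ℝ :=
  (∑ i : Fin d, p.coeff (i + 1) • LinearMap.proj (R := ℝ) (φ := fun _ : Fin d => ℝ) i).toAffineMap +
    AffineMap.const ℝ (Pt d) (p.coeff 0)

theorem coeffFunctional_momentCurve {d : ℕ} {p : Polynomial ℝ} (hp : p.natDegree ≤ d) (s : ℝ) :
    coeffFunctional d p (momentCurve d s) = p.eval s := by
  rw [Polynomial.eval_eq_sum_range' (Nat.lt_succ_of_le hp), Finset.sum_range_succ',
    Finset.sum_range]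
  simp [coeffFunctional, momentCurve]

/-- At most `d / 2` points of the moment curve span a flat that misses the convex hull of any
other points of the curve. -/
theorem disjoint_convexHull_affineSpan_momentCurve {d : ℕ} (hd : 0 < d) {T Y : Finset (Pt d)}
    (hT : (T : Set (Pt d)) ⊆ Set.range (momentCurve d))
    (hY : (Y : Set (Pt d)) ⊆ Set.range (momentCurve d))
    (hTY : Disjoint T Y) (hcard : 2 * T.card ≤ d) :
    Disjoint (convexHull ℝ (Y : Set (Pt d))) (affineSpan ℝ (T : Set (Pt d)) : Set (Pt d)) := by
  set p : Polynomial ℝ := ∏ x ∈ T, (Polynomial.X - Polynomial.C (x ⟨0, hd⟩)) ^ 2 with hp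
  have hdeg : p.natDegree ≤ d := by
    refine (Polynomial.natDegree_prod_le _ _).trans (le_trans ?_ hcard)
    simp [mul_comm]
  have heval (s : ℝ) : p.eval s = ∏ x ∈ T, (s - x ⟨0, hd⟩) ^ 2 := by
    simp [hp, Polynomial.eval_prod]
  have hzero : affineSpan ℝ (T : Set (Pt d)) ≤
      (affineSpan ℝ {(0 : ℝ)}).comap (coeffFunctional d p) := by
    refine affineSpan_le.2 fun x hx => ?_
    obtain ⟨s, rfl⟩ := hT hx
    simp only [AffineSubspace.coe_comap, Set.mem_preimage, AffineSubspace.coe_affineSpan_singleton,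
      Set.mem_singleton_iff, coeffFunctional_momentCurve hdeg, heval]
    exact Finset.prod_eq_zero hx (by simp [momentCurve_apply_zero])
  have hpos : convexHull ℝ (Y : Set (Pt d)) ⊆ coeffFunctional d p ⁻¹' Set.Ioi 0 := by
    refine convexHull_min (fun y hy => ?_) ((convex_Ioi 0).affine_preimage _)
    obtain ⟨s, rfl⟩ := hY hy
    rw [Set.mem_preimage, Set.mem_Ioi, coeffFunctional_momentCurve hdeg, heval]
    refine Finset.prod_pos fun x hx => sq_pos_of_ne_zero (sub_ne_zero.2 ?_)
    rintro rfl
    obtain ⟨r, rfl⟩ := hT hx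
    rw [momentCurve_apply_zero] at hy
    exact Finset.disjoint_left.1 hTY hx hy
  refine Set.disjoint_left.2 fun x hxY hxT => ?_
  have h0 : coeffFunctional d p x = 0 := by simpa using hzero hxT
  exact (hpos hxY).ne' h0

/-- in the trivial range `α(d,λ) ≥ 1`, for any `n ≥ (d-λ+1)+k` points
`γ(t₁), …, γ(t_n)` on the moment curve (with `t₁ < ⋯ < t_n`) there is no subset `T` of
the vertex set `V` with `|T| = d-λ+1` whose affine hull intersects the convex hull of
every `k`-element subset of `V`. -/
theorem no_complete_kneser_transversal_cyclic (k d lam n : ℕ) (hk : 1 ≤ k) (hd : 1 ≤ d)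
    (hlam : 1 ≤ lam) (hdl : lam ≤ d) (hkl : lam + 1 ≤ k) (hα : 1 ≤ alphaVal d lam)
    (hn : (d - lam + 1) + k ≤ n) (t : Fin n → ℝ) (ht : StrictMono t) :
    ¬ ∃ T : Finset (Pt d), T ⊆ cyclicVerts d n t ∧ T.card = d - lam + 1 ∧
      ∀ Y : Finset (Pt d), Y ⊆ cyclicVerts d n t → Y.card = k →
        ((convexHull ℝ (Y : Set (Pt d))) ∩
          ((affineSpan ℝ (T : Set (Pt d)) : AffineSubspace ℝ (Pt d)) : Set (Pt d))).Nonempty := by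
  rintro ⟨T, hTV, hTcard, h⟩
  have hlam' : (d + 1) / 2 + 1 ≤ lam := by
    have hpos : (0 : ℝ) < (((d + 1) / 2 : ℕ) : ℝ) := by
      exact_mod_cast (by omega : 0 < (d + 1) / 2)
    rw [alphaVal, one_le_div hpos] at hα
    exact_mod_cast (by linarith : (((d + 1) / 2 : ℕ) : ℝ) + 1 ≤ lam)
  have hV : (cyclicVerts d n t : Set (Pt d)) ⊆ Set.range (momentCurve d) := by
    intro x hx
    obtain ⟨i, -, rfl⟩ := Finset.mem_image.1 hx
    exact ⟨t i, rfl⟩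
  have hk' : k ≤ (cyclicVerts d n t \ T).card := by
    rw [Finset.card_sdiff_of_subset hTV, card_cyclicVerts hd ht]
    omega
  obtain ⟨Y, hYV, hYcard⟩ := Finset.exists_subset_card_eq hk'
  have hYV' : Y ⊆ cyclicVerts d n t := hYV.trans Finset.sdiff_subset
  obtain ⟨x, hxY, hxT⟩ := h Y hYV' hYcard
  have hTY : Disjoint T Y := Finset.disjoint_sdiff.mono_right hYV
  exact Set.disjoint_left.1 (disjoint_convexHull_affineSpan_momentCurve hd
    ((Finset.coe_subset.2 hTV).trans hV) ((Finset.coe_subset.2 hYV').trans hV) hTY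
    (by omega)) hxY hxT
end
end

section
/- Let k, d, λ ≥ 1 be integers with d ≥ λ and k ≥ λ+1, and suppose α(d,λ) < 1 (the non-trivial range). Then z(k,d,λ) ≤ ζ(k,d,λ) ≤ Z(k,d,λ). -/
open Finset

noncomputable section

/-- The lower bound
`z(k,d,λ) = (d-λ+1) + max { ⌊(k-1)/β(λ,j)⌋·j + ((k-1) mod β(λ,j)) }`, the maximum taken
over `j ∈ {λ+1, …, d-λ+2}` with `j+λ` odd, where `β(λ,j) = (j+λ-1)/2`. -/
def zLow (k d lam : ℕ) : ℕ :=
  (d - lam + 1) +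
    ((Finset.Icc (lam + 1) (d - lam + 2)).filter (fun j => (j + lam) % 2 = 1)).sup
      (fun j => ((k - 1) / ((j + lam - 1) / 2)) * j + (k - 1) % ((j + lam - 1) / 2))

/-- The upper bound `Z(k,d,λ) = (d-λ+1) + ⌊(2-α(d,λ))(k-1)⌋`, as an integer. -/
def ZUpp (k d lam : ℕ) : ℤ :=
  ((d : ℤ) - (lam : ℤ) + 1) + ⌊(2 - alphaVal d lam) * ((k : ℝ) - 1)⌋

open Polynomial in
/-- The affine functional on `ℝ^d` whose restriction to the moment curve is the polynomial `R`,
when `R` has degree at most `d`. -/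
def polyAffine (d : ℕ) (R : ℝ[X]) : Pt d →ᵃ[ℝ] ℝ :=
  (∑ i : Fin d, R.coeff ((i : ℕ) + 1) • (LinearMap.proj i : Pt d →ₗ[ℝ] ℝ)).toAffineMap +
    AffineMap.const ℝ (Pt d) (R.coeff 0)

lemma polyAffine_momentCurve {d : ℕ} {R : Polynomial ℝ} (hR : R.natDegree ≤ d) (s : ℝ) :
    polyAffine d R (momentCurve d s) = R.eval s := by
  rw [Polynomial.eval_eq_sum_range' (Nat.lt_succ_of_le hR), Finset.sum_range_succ',
    Finset.sum_range]
  simp [polyAffine, momentCurve]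

lemma affineIndependent_momentCurve_s3 {d : ℕ} (T : Finset ℝ) (hT : T.card ≤ d + 1) :
    AffineIndependent ℝ (fun s : T => momentCurve d s) := by
  rw [affineIndependent_iff]
  intro s w hw hwp i hi
  have key : ∀ R : Polynomial ℝ, R.natDegree ≤ d → ∑ e ∈ s, w e * R.eval (e : ℝ) = 0 := by
    intro R hR
    have h1 : ∀ e : T, R.eval (e : ℝ) =
        (polyAffine d R).linear (momentCurve d e) + R.coeff 0 := by
      intro e
      rw [← polyAffine_momentCurve hR]
      simp [polyAffine]
    simp_rw [h1, mul_add, Finset.sum_add_distrib, ← Finset.sum_mul, hw, zero_mul, add_zero,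
      ← smul_eq_mul, ← map_smul, ← map_sum, hwp, map_zero]
  have hL := key (Lagrange.basis T id i) (by
    rw [Lagrange.natDegree_basis (Set.injOn_id _) i.2]
    omega)
  rw [Finset.sum_eq_single_of_mem i hi] at hL
  · have h2 := Lagrange.eval_basis_self (v := (id : ℝ → ℝ)) (s := T) (Set.injOn_id _) i.2
    simp only [id] at h2
    rw [h2] at hL
    simpa using hL
  · intro b _ hb
    have h2 := Lagrange.eval_basis_of_ne (v := (id : ℝ → ℝ)) (s := T) (i := i) (j := b)
      (fun h => hb (Subtype.ext h.symm)) b.2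
    simp only [id] at h2
    rw [h2, mul_zero]

lemma finrank_direction_span_momentCurve {d m : ℕ} (hm : m ≤ d) (T : Finset ℝ)
    (hT : T.card = m + 1) :
    Module.finrank ℝ
      (affineSpan ℝ (Set.range fun s : T => momentCurve d s)).direction = m := by
  rw [direction_affineSpan]
  exact (affineIndependent_momentCurve_s3 (d := d) T (by omega)).finrank_vectorSpan (by simpa using hT)

lemma AffineMap.pos_of_mem_convexHull {E : Type*} [AddCommGroup E] [Module ℝ E] (f : E →ᵃ[ℝ] ℝ)
    {Y : Set E} (hY : ∀ y ∈ Y, 0 < f y) {x : E} (hx : x ∈ convexHull ℝ Y) : 0 < f x := by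
  have hconv : Convex ℝ (f ⁻¹' Set.Ioi 0) := (convex_Ioi 0).affine_preimage f
  exact convexHull_min hY hconv hx

lemma AffineMap.eq_zero_of_mem_affineSpan {E : Type*} [AddCommGroup E] [Module ℝ E]
    (f : E →ᵃ[ℝ] ℝ) {Y : Set E} (hY : ∀ y ∈ Y, f y = 0) {x : E}
    (hx : x ∈ affineSpan ℝ Y) : f x = 0 := by
  have h : f x ∈ (affineSpan ℝ Y).map f := AffineSubspace.mem_map_of_mem f hx
  rw [AffineSubspace.map_span] at h
  have h2 : affineSpan ℝ (f '' Y) ≤ affineSpan ℝ {0} := by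
    apply affineSpan_mono
    rintro _ ⟨y, hy, rfl⟩
    exact hY y hy
  simpa using h2 h

/-- A linear functional that is bounded below on an affine subspace is constant on it. -/
lemma LinearMap.eq_of_bddBelow_affineSubspace {E : Type*} [AddCommGroup E] [Module ℝ E]
    (f : E →ₗ[ℝ] ℝ) (L : AffineSubspace ℝ E) {v : ℝ} (hv : ∀ x ∈ L, v < f x) {x y : E}
    (hx : x ∈ L) (hy : y ∈ L) : f x = f y := by
  by_contra hne
  have hne' : f y - f x ≠ 0 := fun h => hne (sub_eq_zero.mp h).symm
  have h := hv _ (AffineMap.lineMap_mem ((v - f x) / (f y - f x)) hx hy)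
  rw [AffineMap.lineMap_apply] at h
  simp only [vsub_eq_sub, vadd_eq_add, map_add, map_smul, map_sub, smul_eq_mul] at h
  rw [div_mul_cancel₀ _ hne'] at h
  linarith

lemma exists_poly_of_linear {d : ℕ} (f : Pt d →ₗ[ℝ] ℝ) (c : ℝ) :
    ∃ R : Polynomial ℝ, R.natDegree ≤ d ∧ ∀ s, R.eval s = c - f (momentCurve d s) := by
  refine ⟨Polynomial.C c - ∑ i : Fin d, Polynomial.C (f (Pi.single i 1)) *
    Polynomial.X ^ ((i : ℕ) + 1), ?_, ?_⟩
  · refine (Polynomial.natDegree_sub_le _ _).trans (max_le (by simp) ?_)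
    refine Polynomial.natDegree_sum_le_of_forall_le _ _ fun i _ => ?_
    exact (Polynomial.natDegree_C_mul_X_pow_le _ _).trans i.2
  · intro s
    have : f (momentCurve d s) = ∑ i : Fin d, s ^ ((i : ℕ) + 1) * f (Pi.single i 1) := by
      conv_lhs => rw [pi_eq_sum_univ' (momentCurve d s)]
      simp [momentCurve]
    rw [this]
    simp only [Polynomial.eval_sub, Polynomial.eval_C, Polynomial.eval_finsetSum,
      Polynomial.eval_mul, Polynomial.eval_pow, Polynomial.eval_X, mul_comm]

/-- Transversals of point sets on the moment curve in terms of polynomials. -/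
lemma hasCKT_image_momentCurve_iff {k d lam : ℕ} (hd : 1 ≤ d) (hlam : 1 ≤ lam) (hdl : lam ≤ d)
    (A : Finset ℝ) :
    HasCKT k d lam (A.image (momentCurve d)) ↔
      ∃ T ⊆ A, T.card = d - lam + 1 ∧ ∀ R : Polynomial ℝ, R.natDegree ≤ d →
        (∀ s ∈ T, R.eval s = 0) → (A.filter fun s => 0 < R.eval s).card < k := by
  have hinj := momentCurve_injective hd
  constructor
  · rintro ⟨L, hL, ⟨T₀, hT₀, hcard, hTL⟩, hconv⟩
    obtain ⟨T, hTA, rfl⟩ := Finset.subset_image_iff.mp hT₀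
    rw [Finset.card_image_of_injective _ hinj] at hcard
    refine ⟨T, hTA, hcard, fun R hR hRT => ?_⟩
    have hspan : affineSpan ℝ (Set.range fun s : T => momentCurve d s) = L := by
      refine (affineIndependent_momentCurve_s3 T (by omega)).affineSpan_eq_of_le_of_card_eq_finrank_add_one
        ?_ ?_
      · rw [affineSpan_le]
        rintro _ ⟨s, rfl⟩
        exact hTL (Finset.mem_coe.mpr (Finset.mem_image_of_mem _ s.2))
      · rw [hL, Fintype.card_coe, hcard]
    by_contra! hk
    obtain ⟨S, hS, hSk⟩ := Finset.exists_subset_card_eq hk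
    obtain ⟨x, hx, hxL⟩ := hconv (S.image (momentCurve d))
      (Finset.image_subset_image (hS.trans (Finset.filter_subset _ _)))
      (by rw [Finset.card_image_of_injective _ hinj, hSk])
    have hpos : 0 < polyAffine d R x := by
      refine AffineMap.pos_of_mem_convexHull _ ?_ hx
      intro y hy
      obtain ⟨s, hs, rfl⟩ := Finset.mem_image.mp (Finset.mem_coe.mp hy)
      rw [polyAffine_momentCurve hR]
      exact (Finset.mem_filter.mp (hS hs)).2
    have hzero : polyAffine d R x = 0 := by
      rw [← hspan] at hxL
      refine AffineMap.eq_zero_of_mem_affineSpan _ ?_ hxL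
      rintro _ ⟨s, rfl⟩
      rw [polyAffine_momentCurve hR]
      exact hRT s s.2
    exact hpos.ne' hzero
  · rintro ⟨T, hTA, hcard, hT⟩
    have hmem : ∀ s ∈ T, momentCurve d s ∈
        affineSpan ℝ (Set.range fun s : T => momentCurve d s) := fun s hs =>
      subset_affineSpan ℝ _ ⟨⟨s, hs⟩, rfl⟩
    refine ⟨affineSpan ℝ (Set.range fun s : T => momentCurve d s),
      finrank_direction_span_momentCurve (by omega) T hcard,
      ⟨T.image (momentCurve d), Finset.image_subset_image hTA,
        by rw [Finset.card_image_of_injective _ hinj, hcard], ?_⟩, ?_⟩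
    · intro y hy
      obtain ⟨s, hs, rfl⟩ := Finset.mem_image.mp (Finset.mem_coe.mp hy)
      exact hmem s hs
    · intro Y hY hYk
      obtain ⟨S, hSA, rfl⟩ := Finset.subset_image_iff.mp hY
      rw [Finset.card_image_of_injective _ hinj] at hYk
      by_contra hemp
      rw [Set.not_nonempty_iff_eq_empty, ← Set.disjoint_iff_inter_eq_empty] at hemp
      obtain ⟨f, u, v, hu, huv, hv⟩ := geometric_hahn_banach_compact_closed
        (convex_convexHull ℝ _)
        (Set.Finite.isCompact_convexHull (𝕜 := ℝ) (S.image (momentCurve d)).finite_toSet)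
        (affineSpan ℝ (Set.range fun s : T => momentCurve d s)).convex
        (AffineSubspace.closed_of_finiteDimensional _) hemp
      obtain ⟨s₀, hs₀⟩ : T.Nonempty := Finset.card_pos.mp (by omega)
      obtain ⟨R, hR, hRe⟩ := exists_poly_of_linear f.toLinearMap (f (momentCurve d s₀))
      have h := hT R hR fun s hs => by
        rw [hRe, sub_eq_zero]
        exact LinearMap.eq_of_bddBelow_affineSubspace f.toLinearMap _ hv (hmem s₀ hs₀) (hmem s hs)
      refine h.not_ge (hYk ▸ Finset.card_le_card fun s hs => ?_)
      rw [Finset.mem_filter, hRe]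
      refine ⟨hSA hs, ?_⟩
      have h1 := hu _ (subset_convexHull ℝ _
        (Finset.mem_coe.mpr (Finset.mem_image_of_mem (momentCurve d) hs)))
      have h2 := hv _ (hmem s₀ hs₀)
      simp only [ContinuousLinearMap.coe_coe]
      linarith

/-- The quadratic polynomial with roots `τ h` and `τ (h + 1)` (cyclically modulo `M`), negative
exactly on the arc of the projective line between these two roots. -/
def arcPoly (M : ℕ) (τ : ℕ → ℝ) (h : ℕ) : Polynomial ℝ :=
  if h + 1 = M then -((Polynomial.X - Polynomial.C (τ 0)) * (Polynomial.X - Polynomial.C (τ h)))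
  else (Polynomial.X - Polynomial.C (τ h)) * (Polynomial.X - Polynomial.C (τ (h + 1)))

lemma arcPoly_natDegree_le (M : ℕ) (τ : ℕ → ℝ) (h : ℕ) : (arcPoly M τ h).natDegree ≤ 2 := by
  unfold arcPoly
  split_ifs
  · rw [Polynomial.natDegree_neg]
    exact Polynomial.natDegree_mul_le.trans (by simp)
  · exact Polynomial.natDegree_mul_le.trans (by simp)

lemma arcPoly_eval_left (M : ℕ) (τ : ℕ → ℝ) (h : ℕ) : (arcPoly M τ h).eval (τ h) = 0 := by
  unfold arcPoly
  split_ifs <;> simp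

lemma arcPoly_eval_right {M : ℕ} (τ : ℕ → ℝ) {h : ℕ} (hh : h < M) :
    (arcPoly M τ h).eval (τ ((h + 1) % M)) = 0 := by
  unfold arcPoly
  split_ifs with h1
  · simp [h1]
  · rw [Nat.mod_eq_of_lt (by omega)]
    simp

lemma exists_forall_arcPoly_pos {M : ℕ} {τ : ℕ → ℝ} (hτ : StrictMonoOn τ (Set.Iio M)) {s : ℝ}
    (hs : ∀ i < M, τ i ≠ s) : ∃ c, ∀ h < M, h ≠ c → 0 < (arcPoly M τ h).eval s := by
  by_cases hall : ∀ i < M, τ i < s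
  · refine ⟨M - 1, fun h hM hne => ?_⟩
    rw [arcPoly, if_neg (by omega)]
    have h1 := hall h hM
    have h2 := hall (h + 1) (by omega)
    simp only [Polynomial.eval_mul, Polynomial.eval_sub, Polynomial.eval_X, Polynomial.eval_C]
    exact mul_pos (by linarith) (by linarith)
  · push Not at hall
    classical
    obtain ⟨hcM, hc⟩ := Nat.find_spec hall
    set c := Nat.find hall with hcdef
    have hlow : ∀ i < c, τ i < s := fun i hi => by
      have := Nat.find_min hall hi
      push Not at this
      exact this (by omega)
    have hhigh : ∀ i < M, c ≤ i → s < τ i := fun i hi hci =>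
      lt_of_le_of_ne (hc.trans (hτ.monotoneOn hcM hi hci)) (hs i hi).symm
    refine ⟨if c = 0 then M - 1 else c - 1, fun h hM hne => ?_⟩
    unfold arcPoly
    split_ifs at hne ⊢ with h0 h1 h1
    · omega
    · have h2 := hlow 0 (by omega)
      have h3 := hhigh h hM (by omega)
      simp only [Polynomial.eval_mul, Polynomial.eval_sub, Polynomial.eval_X, Polynomial.eval_C,
        Polynomial.eval_neg]
      exact neg_pos.mpr (mul_neg_of_pos_of_neg (by linarith) (by linarith))
    · have h2 := hhigh h hM (by omega)
      have h3 := hhigh (h + 1) (by omega) (by omega)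
      simp only [Polynomial.eval_mul, Polynomial.eval_sub, Polynomial.eval_X, Polynomial.eval_C]
      exact mul_pos_of_neg_of_neg (by linarith) (by linarith)
    · simp only [Polynomial.eval_mul, Polynomial.eval_sub, Polynomial.eval_X, Polynomial.eval_C]
      by_cases hlt : h < c
      · have h2 := hlow h hlt
        have h3 := hlow (h + 1) (by omega)
        exact mul_pos (by linarith) (by linarith)
      · have h2 := hhigh h hM (by omega)
        have h3 := hhigh (h + 1) (by omega) (by omega)
        exact mul_pos_of_neg_of_neg (by linarith) (by linarith)

/-- The product of `e` alternate arc polynomials starting at index `r`, times the squares of the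
linear factors at the remaining nodes. -/
def rotatedArcPoly (M e : ℕ) (τ : ℕ → ℝ) (r : ℕ) : Polynomial ℝ :=
  (∏ i ∈ Finset.range e, arcPoly M τ ((r + 2 * i) % M)) *
    ∏ u ∈ Finset.Ico (2 * e) M, (Polynomial.X - Polynomial.C (τ ((r + u) % M))) ^ 2

lemma rotatedArcPoly_natDegree_le {M e D : ℕ} (hM : M = D + e) (he : 2 * e ≤ M) (τ : ℕ → ℝ)
    (r : ℕ) : (rotatedArcPoly M e τ r).natDegree ≤ 2 * D := by
  refine Polynomial.natDegree_mul_le.trans ?_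
  have h1 : (∏ i ∈ Finset.range e, arcPoly M τ ((r + 2 * i) % M)).natDegree ≤ e * 2 := by
    refine (Polynomial.natDegree_prod_le _ _).trans ?_
    refine (Finset.sum_le_card_nsmul _ _ 2 fun i _ => arcPoly_natDegree_le M τ _).trans ?_
    simp
  have h2 : (∏ u ∈ Finset.Ico (2 * e) M,
      (Polynomial.X - Polynomial.C (τ ((r + u) % M))) ^ 2).natDegree ≤ (M - 2 * e) * 2 := by
    refine (Polynomial.natDegree_prod_le _ _).trans ?_
    refine (Finset.sum_le_card_nsmul _ _ 2 fun i _ => ?_).trans (by simp)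
    exact Polynomial.natDegree_pow_le.trans (by simp)
  omega

lemma rotatedArcPoly_eval_node {M e : ℕ} (τ : ℕ → ℝ) {r h : ℕ} (hr : r < M) (hh : h < M) :
    (rotatedArcPoly M e τ r).eval (τ h) = 0 := by
  obtain ⟨u, huM, hu⟩ : ∃ u < M, (r + u) % M = h := by
    by_cases hrh : r ≤ h
    · exact ⟨h - r, by omega, by rw [Nat.add_sub_cancel' hrh, Nat.mod_eq_of_lt hh]⟩
    · refine ⟨h + M - r, by omega, ?_⟩
      rw [show r + (h + M - r) = h + M by omega, Nat.add_mod_right, Nat.mod_eq_of_lt hh]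
  rw [rotatedArcPoly, Polynomial.eval_mul, Polynomial.eval_prod, Polynomial.eval_prod]
  by_cases hue : u < 2 * e
  · refine mul_eq_zero_of_left
      (Finset.prod_eq_zero (Finset.mem_range.mpr (show u / 2 < e by omega)) ?_) _
    rcases Nat.even_or_odd' u with ⟨i, rfl | rfl⟩
    · rw [Nat.mul_div_cancel_left _ two_pos, hu]
      exact arcPoly_eval_left M τ h
    · rw [show (2 * i + 1) / 2 = i by omega, ← hu,
        show (r + (2 * i + 1)) % M = ((r + 2 * i) % M + 1) % M by
          rw [Nat.mod_add_mod, add_assoc]]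
      exact arcPoly_eval_right τ (Nat.mod_lt _ (by omega))
  · refine mul_eq_zero_of_right _
      (Finset.prod_eq_zero (Finset.mem_Ico.mpr ⟨not_lt.mp hue, huM⟩) ?_)
    simp [hu]

lemma rotatedArcPoly_eval_pos {M e : ℕ} {τ : ℕ → ℝ} {s : ℝ} (hM : 0 < M)
    (hs : ∀ i < M, τ i ≠ s) {c : ℕ} (hc : ∀ h < M, h ≠ c → 0 < (arcPoly M τ h).eval s) {r : ℕ}
    (hr : ∀ i < e, (r + 2 * i) % M ≠ c) : 0 < (rotatedArcPoly M e τ r).eval s := by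
  rw [rotatedArcPoly, Polynomial.eval_mul, Polynomial.eval_prod, Polynomial.eval_prod]
  refine mul_pos (Finset.prod_pos fun i hi => hc _ (Nat.mod_lt _ hM)
    (hr i (Finset.mem_range.mp hi))) (Finset.prod_pos fun u _ => ?_)
  have := sub_ne_zero.mpr (hs ((r + u) % M) (Nat.mod_lt _ hM)).symm
  simp only [Polynomial.eval_pow, Polynomial.eval_sub, Polynomial.eval_X, Polynomial.eval_C]
  positivity

lemma card_bad_rotations_le (M e c : ℕ) :
    ((Finset.range M).filter fun r => ∃ i < e, (r + 2 * i) % M = c).card ≤ e := by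
  have hsub : ((Finset.range M).filter fun r => ∃ i < e, (r + 2 * i) % M = c) ⊆
      (Finset.range e).biUnion fun i => (Finset.range M).filter fun r => (r + 2 * i) % M = c := by
    intro r hr
    simp only [Finset.mem_filter, Finset.mem_biUnion, Finset.mem_range] at hr ⊢
    obtain ⟨h1, i, hi, h2⟩ := hr
    exact ⟨i, hi, h1, h2⟩
  refine (Finset.card_le_card hsub).trans ((Finset.card_biUnion_le_card_mul _ _ 1 ?_).trans
    (by simp))
  intro i _
  refine Finset.card_le_one.mpr fun a ha b hb => ?_
  simp only [Finset.mem_filter, Finset.mem_range] at ha hb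
  have h : a + 2 * i ≡ b + 2 * i [MOD M] := ha.2.trans hb.2.symm
  exact (Nat.ModEq.add_right_cancel' _ h).eq_of_lt_of_lt ha.1 hb.1

lemma exists_strictMonoOn_enum (T : Finset ℝ) :
    ∃ τ : ℕ → ℝ, StrictMonoOn τ (Set.Iio T.card) ∧ ∀ s, s ∈ T ↔ ∃ i < T.card, τ i = s := by
  refine ⟨fun i => if h : i < T.card then T.orderEmbOfFin rfl ⟨i, h⟩ else 0, ?_, ?_⟩
  · intro a ha b hb hab
    simp only [Set.mem_Iio] at ha hb
    simpa [ha, hb] using hab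
  · intro s
    have : s ∈ T ↔ s ∈ Set.range (T.orderEmbOfFin rfl) := by
      rw [Finset.range_orderEmbOfFin, Finset.mem_coe]
    rw [this]
    constructor
    · rintro ⟨i, rfl⟩
      exact ⟨i, i.2, by simp⟩
    · rintro ⟨i, hi, rfl⟩
      exact ⟨⟨i, hi⟩, by simp [hi]⟩

/-- If no polynomial of degree at most `2 D` vanishing on `T` is positive at more than `K` points
of `U`, then `U` is small. -/
lemma mul_card_le_of_forall_poly {D e K : ℕ} {T U : Finset ℝ} (hTU : Disjoint T U)
    (hM : T.card = D + e) (he : 2 * e ≤ T.card) (hpos : 0 < T.card)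
    (hR : ∀ R : Polynomial ℝ, R.natDegree ≤ 2 * D → (∀ s ∈ T, R.eval s = 0) →
      (U.filter fun s => 0 < R.eval s).card ≤ K) :
    D * U.card ≤ T.card * K := by
  obtain ⟨τ, hτ, hτT⟩ := exists_strictMonoOn_enum T
  set M := T.card
  calc D * U.card = ∑ s ∈ U, D := by simp [mul_comm]
    _ ≤ ∑ s ∈ U, ((Finset.range M).filter fun r => 0 < (rotatedArcPoly M e τ r).eval s).card := by
        refine Finset.sum_le_sum fun s hs => ?_
        have hns : ∀ i < M, τ i ≠ s := fun i hi h =>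
          Finset.disjoint_left.mp hTU ((hτT s).mpr ⟨i, hi, h⟩) hs
        obtain ⟨c, hc⟩ := exists_forall_arcPoly_pos hτ hns
        have h1 := card_bad_rotations_le M e c
        have h2 := Finset.card_filter_add_card_filter_not (s := Finset.range M)
          (fun r => ∃ i < e, (r + 2 * i) % M = c)
        rw [Finset.card_range] at h2
        have h3 : ((Finset.range M).filter fun r => ¬ ∃ i < e, (r + 2 * i) % M = c).card ≤
            ((Finset.range M).filter fun r => 0 < (rotatedArcPoly M e τ r).eval s).card := by
          refine Finset.card_le_card (Finset.monotone_filter_right _ fun r _ hr => ?_)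
          push Not at hr
          exact rotatedArcPoly_eval_pos hpos hns hc hr
        omega
    _ = ∑ r ∈ Finset.range M, (U.filter fun s => 0 < (rotatedArcPoly M e τ r).eval s).card := by
        simp_rw [Finset.card_filter]
        exact Finset.sum_comm
    _ ≤ ∑ r ∈ Finset.range M, K := by
        refine Finset.sum_le_sum fun r hr => hR _ (rotatedArcPoly_natDegree_le hM he τ r) ?_
        intro s hs
        obtain ⟨i, hi, rfl⟩ := (hτT s).mp hs
        exact rotatedArcPoly_eval_node τ (Finset.mem_range.mp hr) hi
    _ = M * K := by simp

/-- The version of `mul_card_le_of_forall_poly` for polynomials of odd degree: one node is moved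
to infinity. -/
lemma mul_card_le_of_forall_poly_odd {D e K : ℕ} {T U : Finset ℝ} (hTU : Disjoint T U)
    (hM : T.card + 1 = D + e) (he : 2 * e ≤ T.card + 1)
    (hR : ∀ R : Polynomial ℝ, R.natDegree ≤ 2 * D - 1 → (∀ s ∈ T, R.eval s = 0) →
      (U.filter fun s => 0 < R.eval s).card ≤ K) :
    D * U.card ≤ (T.card + 1) * K := by
  obtain ⟨B, hB⟩ := (T ∪ U).exists_le
  have hBlt : ∀ s ∈ T ∪ U, s < B + 1 := fun s hs => (hB s hs).trans_lt (lt_add_one B)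
  have hBT : B + 1 ∉ T := fun h => (hBlt _ (Finset.mem_union_left _ h)).false
  have hBU : B + 1 ∉ U := fun h => (hBlt _ (Finset.mem_union_right _ h)).false
  have hcard := Finset.card_insert_of_notMem hBT
  rw [← hcard]
  refine mul_card_le_of_forall_poly (e := e) (Finset.disjoint_insert_left.mpr ⟨hBU, hTU⟩)
    (by omega) (by omega) (by omega) fun R hRd hRT => ?_
  obtain ⟨Q, rfl⟩ := Polynomial.dvd_iff_isRoot.mpr (hRT _ (Finset.mem_insert_self _ _))
  have heval : ∀ s, ((Polynomial.X - Polynomial.C (B + 1)) * Q).eval s =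
      (B + 1 - s) * (-Q).eval s := fun s => by
    simp only [Polynomial.eval_mul, Polynomial.eval_sub, Polynomial.eval_X, Polynomial.eval_C,
      Polynomial.eval_neg]
    ring
  refine (Finset.card_le_card (Finset.monotone_filter_right U fun s hs h => ?_)).trans
    (hR (-Q) ?_ ?_)
  · rw [heval] at h
    exact pos_of_mul_pos_right h (sub_pos.mpr (hBlt s (Finset.mem_union_right _ hs))).le
  · rw [Polynomial.natDegree_neg]
    rcases eq_or_ne Q 0 with rfl | hQ
    · simp
    · rw [Polynomial.natDegree_mul (Polynomial.X_sub_C_ne_zero _) hQ,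
        Polynomial.natDegree_X_sub_C] at hRd
      omega
  · intro s hs
    have h := hRT s (Finset.mem_insert_of_mem hs)
    rw [heval] at h
    exact (mul_eq_zero.mp h).resolve_left
      (sub_pos.mpr (hBlt s (Finset.mem_union_left _ hs))).ne'

/-- If the values of `P` alternate in sign along an increasing sequence, then multiplication by a
polynomial with few roots can make only about half of them positive. -/
lemma two_mul_card_pos_le {P q : Polynomial ℝ} {j m : ℕ} {y : ℕ → ℝ}
    (hy : StrictMonoOn y (Set.Iio j)) (hq : q ≠ 0) (hqm : q.natDegree ≤ m)
    (hP : ∀ i, i + 1 < j → P.eval (y i) * P.eval (y (i + 1)) < 0) :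
    2 * ((Finset.range j).filter fun i => 0 < (P * q).eval (y i)).card ≤ j + 1 + m := by
  set S := (Finset.range j).filter fun i => 0 < (P * q).eval (y i) with hS
  have hunion : (S ∪ S.image Nat.succ).card ≤ j + 1 := by
    rw [← Finset.card_range (j + 1)]
    refine Finset.card_le_card fun i hi => ?_
    simp only [hS, Finset.mem_union, Finset.mem_image, Finset.mem_filter, Finset.mem_range] at hi ⊢
    omega
  have hadd := Finset.card_union_add_card_inter S (S.image Nat.succ)
  rw [Finset.card_image_of_injective _ Nat.succ_injective] at hadd
  have hroot : ∀ i ∈ S ∩ S.image Nat.succ, ∃ x, q.IsRoot x ∧ y (i - 1) < x ∧ x < y i := by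
    intro i hi
    simp only [hS, Finset.mem_inter, Finset.mem_image, Finset.mem_filter, Finset.mem_range,
      Polynomial.eval_mul] at hi
    obtain ⟨⟨hij, hpos⟩, i, ⟨-, hpos'⟩, rfl⟩ := hi
    have hlt : y i < y (i + 1) := hy (by simp; omega) hij (by omega)
    have hneg : q.eval (y i) * q.eval (y (i + 1)) < 0 := by
      have h1 := mul_pos hpos' hpos
      have h2 := hP i hij
      simp only [Nat.succ_eq_add_one] at h1
      by_contra! hcon
      nlinarith [mul_nonneg hcon (neg_nonneg.mpr h2.le)]
    have hcont : ContinuousOn (fun x => q.eval x) (Set.Icc (y i) (y (i + 1))) :=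
      q.continuous.continuousOn
    simp only [Nat.succ_eq_add_one, Nat.add_sub_cancel]
    rcases mul_neg_iff.mp hneg with ⟨h1, h2⟩ | ⟨h1, h2⟩
    · obtain ⟨x, hx, hx0⟩ := intermediate_value_Ioo' hlt.le hcont ⟨h2, h1⟩
      exact ⟨x, hx0, hx.1, hx.2⟩
    · obtain ⟨x, hx, hx0⟩ := intermediate_value_Ioo hlt.le hcont ⟨h1, h2⟩
      exact ⟨x, hx0, hx.1, hx.2⟩
  choose! x hx hx1 hx2 using hroot
  have hinter : (S ∩ S.image Nat.succ).card ≤ m := by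
    refine le_trans ?_ (((Multiset.toFinset_card_le q.roots).trans q.card_roots').trans hqm)
    refine Finset.card_le_card_of_injOn x (fun i hi => ?_) ?_
    · simpa [hq] using hx i hi
    · have key : ∀ a ∈ S ∩ S.image Nat.succ, ∀ b ∈ S ∩ S.image Nat.succ, a < b → x a < x b := by
        intro a ha b hb hab
        have hbj : b < j := by
          have := Finset.mem_of_mem_inter_left hb
          simp only [hS, Finset.mem_filter, Finset.mem_range] at this
          exact this.1
        have : y a ≤ y (b - 1) := hy.monotoneOn (by simp; omega) (by simp; omega) (by omega)
        linarith [hx2 a ha, hx1 b hb]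
      intro a ha b hb hab
      rcases lt_trichotomy a b with h | h | h
      · exact absurd hab (key a ha b hb h).ne
      · exact h
      · exact absurd hab (key b hb a ha h).ne'
  omega

lemma eval_prod_mul_eval_prod_neg {T : Finset ℝ} {x y τ : ℝ} (hτ : τ ∈ T) (hx : x < τ)
    (hy : τ < y) (hT : ∀ σ ∈ T, σ ≠ τ → σ < x ∨ y < σ) :
    (∏ σ ∈ T, (Polynomial.X - Polynomial.C σ)).eval x *
      (∏ σ ∈ T, (Polynomial.X - Polynomial.C σ)).eval y < 0 := by
  rw [Polynomial.eval_prod, Polynomial.eval_prod, ← Finset.prod_mul_distrib,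
    ← Finset.mul_prod_erase _ _ hτ]
  simp only [Polynomial.eval_sub, Polynomial.eval_X, Polynomial.eval_C]
  refine mul_neg_of_neg_of_pos (mul_neg_of_neg_of_pos (by linarith) (by linarith))
    (Finset.prod_pos fun σ hσ => ?_)
  rcases hT σ (Finset.mem_of_mem_erase hσ) (Finset.ne_of_mem_erase hσ) with h | h
  · exact mul_pos (by linarith) (by linarith)
  · exact mul_pos_of_neg_of_neg (by linarith) (by linarith)

lemma exists_eq_mul_prod_of_eval_eq_zero {T : Finset ℝ} {R : Polynomial ℝ} {d : ℕ}
    (hd : R.natDegree ≤ d) (hR : ∀ s ∈ T, R.eval s = 0) :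
    ∃ q : Polynomial ℝ, R = (∏ σ ∈ T, (Polynomial.X - Polynomial.C σ)) * q ∧
      q.natDegree ≤ d - T.card := by
  obtain ⟨q, hq⟩ : (∏ σ ∈ T, (Polynomial.X - Polynomial.C σ)) ∣ R := by
    refine Finset.prod_dvd_of_coprime ?_ fun s hs => Polynomial.dvd_iff_isRoot.mpr (hR s hs)
    intro a _ b _ hab
    exact Polynomial.isCoprime_X_sub_C_of_isUnit_sub (sub_ne_zero.mpr hab).isUnit
  refine ⟨q, hq, ?_⟩
  rcases eq_or_ne q 0 with rfl | hq0
  · simp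
  · have hmonic : (∏ σ ∈ T, (Polynomial.X - Polynomial.C σ)).Monic :=
      Polynomial.monic_prod_of_monic _ _ fun σ _ => Polynomial.monic_X_sub_C σ
    have hdeg : (∏ σ ∈ T, (Polynomial.X - Polynomial.C σ)).natDegree = T.card := by simp
    rw [hq, hmonic.natDegree_mul' hq0, hdeg] at hd
    omega

/-- Positions of `m` nodes separating `J + 1` blocks of `a` consecutive indices, the surplus nodes
being placed after the last block. -/
def blockNodes (a J m : ℕ) : Finset ℕ :=
  (Finset.range J).image (fun i => i * (a + 1) + a) ∪
    Finset.Ico (J * (a + 1) + a) (J * (a + 1) + a + (m - J))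

lemma mem_blockNodes {a J m u : ℕ} : u ∈ blockNodes a J m ↔
    (∃ i < J, i * (a + 1) + a = u) ∨
      J * (a + 1) + a ≤ u ∧ u < J * (a + 1) + a + (m - J) := by
  simp [blockNodes]

lemma card_blockNodes {a J m : ℕ} (hJ : J ≤ m) : (blockNodes a J m).card = m := by
  have hinj : Function.Injective fun i => i * (a + 1) + a := fun i i' h => by
    simpa using h
  rw [blockNodes, Finset.card_union_of_disjoint, Finset.card_image_of_injective _ hinj]
  · simp
    omega
  · refine Finset.disjoint_left.mpr fun u hu hu' => ?_
    obtain ⟨i, hi, rfl⟩ := Finset.mem_image.mp hu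
    have h1 := Nat.mul_lt_mul_of_pos_right (Finset.mem_range.mp hi) (Nat.succ_pos a)
    have h2 := (Finset.mem_Ico.mp hu').1
    simp only [Nat.succ_eq_add_one] at h1
    omega

lemma lt_of_mem_blockNodes {a J m u : ℕ} (hJ : J ≤ m) (hu : u ∈ blockNodes a J m) :
    u < (J + 1) * a + m := by
  have h3 : J * (a + 1) + a = (J + 1) * a + J := by ring
  rcases mem_blockNodes.mp hu with ⟨i, hi, rfl⟩ | ⟨-, h⟩
  · have h1 := Nat.mul_lt_mul_of_pos_right hi (Nat.succ_pos a)
    simp only [Nat.succ_eq_add_one] at h1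
    omega
  · omega

lemma exists_block_of_notMem {a J m u : ℕ} (hJ : J ≤ m) (hu : u ∉ blockNodes a J m)
    (hlt : u < (J + 1) * a + m) : ∃ l < a, ∃ i < J + 1, i * (a + 1) + l = u := by
  rw [mem_blockNodes] at hu
  push Not at hu
  have h3 : J * (a + 1) + a = (J + 1) * a + J := by ring
  have hltJ : u < J * (a + 1) + a := by
    by_contra! h
    have := hu.2 h
    omega
  have hdm := Nat.div_add_mod' u (a + 1)
  have hml := Nat.mod_lt u (Nat.add_one_pos a)
  have hne : u % (a + 1) ≠ a := by
    intro h
    rw [h] at hdm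
    exact hu.1 _ (lt_of_mul_lt_mul_right (by omega : u / (a + 1) * (a + 1) < J * (a + 1))
      (Nat.zero_le _)) hdm
  refine ⟨u % (a + 1), by omega, u / (a + 1), ?_, hdm⟩
  rw [Nat.div_lt_iff_lt_mul (Nat.add_one_pos a), Nat.succ_mul]
  omega

lemma card_pos_le_of_blockNodes {x : ℕ → ℝ} {a J m r d lam : ℕ}
    (hx : StrictMonoOn x (Set.Iio ((J + 1) * a + m + r))) (hJ : J ≤ m) (hlam : 1 ≤ lam)
    (hm : m + lam = d + 1) {R : Polynomial ℝ} (hRd : R.natDegree ≤ d)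
    (hR : ∀ s ∈ (blockNodes a J m).image x, R.eval s = 0) :
    (((Finset.range ((J + 1) * a + m + r)).image x).filter fun s => 0 < R.eval s).card ≤
      a * ((J + 1 + lam) / 2) + r := by
  have hlen : J * (a + 1) + a = (J + 1) * a + J := by ring
  have hcard : ((blockNodes a J m).image x).card = m := by
    rw [Finset.card_image_of_injOn, card_blockNodes hJ]
    refine hx.injOn.mono fun u hu => ?_
    have := lt_of_mem_blockNodes hJ hu
    simp only [Set.mem_Iio]
    omega
  obtain ⟨q, hRq, hq⟩ := exists_eq_mul_prod_of_eval_eq_zero hRd hR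
  rw [hcard] at hq
  rcases eq_or_ne q 0 with rfl | hq0
  · simp [hRq]
  have hlayer : ∀ l < a, ((Finset.range (J + 1)).filter
      fun i => 0 < R.eval (x (i * (a + 1) + l))).card ≤ (J + 1 + lam) / 2 := by
    intro l hl
    have hbd : ∀ i < J + 1, i * (a + 1) + l < (J + 1) * a + m + r := fun i hi => by
      have := Nat.mul_le_mul_right (a + 1) (Nat.le_of_lt_succ hi)
      omega
    have h := two_mul_card_pos_le (P := ∏ σ ∈ (blockNodes a J m).image x,
      (Polynomial.X - Polynomial.C σ)) (y := fun i => x (i * (a + 1) + l)) (j := J + 1)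
      (m := lam - 1) ?_ hq0 (hq.trans (by omega)) ?_
    · rw [← hRq] at h
      omega
    · intro i hi i' hi' hii
      refine hx (hbd i hi) (hbd i' hi') ?_
      have := Nat.mul_lt_mul_of_pos_right hii (Nat.succ_pos a)
      simp only [Nat.succ_eq_add_one] at this
      omega
    · intro i hi
      have hmem : i * (a + 1) + a ∈ blockNodes a J m :=
        mem_blockNodes.mpr (Or.inl ⟨i, by omega, rfl⟩)
      have hmem' := lt_of_mem_blockNodes hJ hmem
      have hsucc := Nat.succ_mul i (a + 1)
      simp only [Nat.succ_eq_add_one] at hsucc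
      have hb := hbd (i + 1) hi
      refine eval_prod_mul_eval_prod_neg (Finset.mem_image_of_mem x hmem)
        (hx (hbd i (by omega)) (by simp only [Set.mem_Iio]; omega) (by omega))
        (hx (by simp only [Set.mem_Iio]; omega) hb (by omega)) ?_
      intro σ hσ hne
      obtain ⟨u, hu, rfl⟩ := Finset.mem_image.mp hσ
      have hult := lt_of_mem_blockNodes hJ hu
      have hune : u ≠ i * (a + 1) + a := fun h => hne (by rw [h])
      suffices u < i * (a + 1) + l ∨ (i + 1) * (a + 1) + l < u by
        rcases this with h | h
        · exact Or.inl (hx (by simp only [Set.mem_Iio]; omega) (hbd i (by omega)) h)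
        · exact Or.inr (hx hb (by simp only [Set.mem_Iio]; omega) h)
      rcases mem_blockNodes.mp hu with ⟨i', hi', rfl⟩ | ⟨h, -⟩
      · rcases lt_trichotomy i' i with h | h | h
        · have h1 := Nat.mul_le_mul_right (a + 1) (Nat.succ_le_of_lt h)
          rw [Nat.succ_mul] at h1
          omega
        · exact absurd (by rw [h]) hune
        · have h1 := Nat.mul_le_mul_right (a + 1) (Nat.succ_le_of_lt h)
          simp only [Nat.succ_eq_add_one] at h1
          omega
      · have h1 := Nat.mul_le_mul_right (a + 1) (Nat.le_of_lt_succ hi)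
        omega
  have hsub : (((Finset.range ((J + 1) * a + m + r)).image x).filter fun s => 0 < R.eval s) ⊆
      (((Finset.range a).biUnion fun l => ((Finset.range (J + 1)).filter
        fun i => 0 < R.eval (x (i * (a + 1) + l))).image fun i => i * (a + 1) + l) ∪
        Finset.Ico ((J + 1) * a + m) ((J + 1) * a + m + r)).image x := by
    intro s hs
    obtain ⟨hs, hpos⟩ := Finset.mem_filter.mp hs
    obtain ⟨u, hu, rfl⟩ := Finset.mem_image.mp hs
    refine Finset.mem_image_of_mem x ?_
    have hun : u ∉ blockNodes a J m := fun h =>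
      hpos.ne' (hR _ (Finset.mem_image_of_mem x h))
    rcases lt_or_ge u ((J + 1) * a + m) with hlt | hge
    · obtain ⟨l, hl, i, hi, rfl⟩ := exists_block_of_notMem hJ hun hlt
      refine Finset.mem_union_left _ (Finset.mem_biUnion.mpr ⟨l, Finset.mem_range.mpr hl, ?_⟩)
      exact Finset.mem_image.mpr
        ⟨i, Finset.mem_filter.mpr ⟨Finset.mem_range.mpr hi, hpos⟩, rfl⟩
    · exact Finset.mem_union_right _ (Finset.mem_Ico.mpr ⟨hge, Finset.mem_range.mp hu⟩)
  refine (Finset.card_le_card hsub).trans (Finset.card_image_le.trans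
    ((Finset.card_union_le _ _).trans (add_le_add ?_ (by simp))))
  refine (Finset.card_biUnion_le_card_mul _ _ _ fun l hl => Finset.card_image_le.trans
    (hlayer l (Finset.mem_range.mp hl))).trans (by simp)

lemma block_count_mem_zetaSet {k d lam j : ℕ} (hd : 1 ≤ d) (hlam : 1 ≤ lam) (hdl : lam ≤ d)
    (hk : 1 ≤ k) (hj : lam + 1 ≤ j) (hjd : j ≤ d - lam + 2) (hodd : (j + lam) % 2 = 1) :
    (d - lam + 1) + ((k - 1) / ((j + lam - 1) / 2) * j + (k - 1) % ((j + lam - 1) / 2)) ∈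
      zetaSet k d lam := by
  obtain ⟨J, rfl⟩ : ∃ J, j = J + 1 := ⟨j - 1, by omega⟩
  have hβ : (J + 1 + lam - 1) / 2 = (J + 1 + lam) / 2 := by omega
  rw [hβ]
  have hdiv := Nat.div_add_mod' (k - 1) ((J + 1 + lam) / 2)
  set a := (k - 1) / ((J + 1 + lam) / 2)
  set r := (k - 1) % ((J + 1 + lam) / 2)
  rw [show (d - lam + 1) + (a * (J + 1) + r) = (J + 1) * a + (d - lam + 1) + r by ring]
  set m := d - lam + 1 with hm
  set n := (J + 1) * a + m + r
  refine ⟨by omega, fun t ht => ?_⟩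
  set x : ℕ → ℝ := fun i => if h : i < n then t ⟨i, h⟩ else 0 with hxdef
  have hx : StrictMonoOn x (Set.Iio n) := by
    intro i hi i' hi' hii
    simp only [Set.mem_Iio] at hi hi'
    simpa [hxdef, hi, hi'] using ht (show (⟨i, hi⟩ : Fin n) < ⟨i', hi'⟩ from hii)
  have hA : cyclicVerts d n t = ((Finset.range n).image x).image (momentCurve d) := by
    ext p
    simp only [cyclicVerts, Finset.mem_image, Finset.mem_univ, true_and, Finset.mem_range,
      exists_exists_and_eq_and]
    constructor
    · rintro ⟨i, rfl⟩
      exact ⟨i, i.2, by simp [hxdef]⟩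
    · rintro ⟨i, hi, rfl⟩
      exact ⟨⟨i, hi⟩, by simp [hxdef, hi]⟩
  have hJ : J ≤ m := by omega
  have hsub : blockNodes a J m ⊆ Finset.range n := fun u hu =>
    Finset.mem_range.mpr ((lt_of_mem_blockNodes hJ hu).trans_le (Nat.le_add_right _ _))
  rw [hA, hasCKT_image_momentCurve_iff hd hlam hdl]
  refine ⟨(blockNodes a J m).image x, Finset.image_subset_image hsub, ?_, fun R hRd hR => ?_⟩
  · rw [Finset.card_image_of_injOn, card_blockNodes hJ]
    exact hx.injOn.mono fun u hu => Finset.mem_range.mp (hsub hu)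
  · exact (card_pos_le_of_blockNodes hx hJ hlam (by omega) hRd hR).trans_lt (by omega)

lemma mul_le_of_mem_zetaSet {k d lam n : ℕ} (hd : 1 ≤ d) (hlam : 1 ≤ lam) (hdl : lam ≤ d)
    (hD : lam ≤ (d + 1) / 2) (hn : n ∈ zetaSet k d lam) :
    d - lam + 1 ≤ n ∧ (d + 1) / 2 * (n - (d - lam + 1)) ≤
      (2 * ((d + 1) / 2) + 1 - lam) * (k - 1) := by
  have h := hn.2 (fun i => ((i : ℕ) : ℝ)) (fun i i' h => by simpa using h)
  set A : Finset ℝ := Finset.univ.image fun i : Fin n => ((i : ℕ) : ℝ) with hAdef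
  have hA : cyclicVerts d n (fun i => ((i : ℕ) : ℝ)) = A.image (momentCurve d) := by
    rw [hAdef, Finset.image_image]
    rfl
  have hAcard : A.card = n := by
    rw [hAdef, Finset.card_image_of_injective _ (fun i i' h => by simpa [Fin.ext_iff] using h)]
    simp
  rw [hA, hasCKT_image_momentCurve_iff hd hlam hdl] at h
  obtain ⟨T, hTA, hT, hR⟩ := h
  have hle := Finset.card_le_card hTA
  have hU := Finset.card_sdiff_of_subset hTA
  have hR' : ∀ R : Polynomial ℝ, R.natDegree ≤ d → (∀ s ∈ T, R.eval s = 0) →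
      ((A \ T).filter fun s => 0 < R.eval s).card ≤ k - 1 := fun R h1 h2 =>
    (Finset.card_le_card (Finset.filter_subset_filter _ Finset.sdiff_subset)).trans
      (Nat.le_sub_one_of_lt (hR R h1 h2))
  refine ⟨by omega, ?_⟩
  rw [← hAcard, ← hT, ← hU]
  rcases Nat.even_or_odd' d with ⟨c, hc | hc⟩
  · have := mul_card_le_of_forall_poly (D := (d + 1) / 2) (e := (d + 1) / 2 + 1 - lam)
      (Finset.disjoint_sdiff (s := T) (t := A)) (by omega) (by omega) (by omega)
      (fun R hRd => hR' R (by omega))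
    rwa [show T.card = 2 * ((d + 1) / 2) + 1 - lam by omega] at this
  · have := mul_card_le_of_forall_poly_odd (D := (d + 1) / 2) (e := (d + 1) / 2 + 1 - lam)
      (Finset.disjoint_sdiff (s := T) (t := A)) (by omega) (by omega)
      (fun R hRd => hR' R (by omega))
    rwa [show T.card + 1 = 2 * ((d + 1) / 2) + 1 - lam by omega] at this

/-- in the non-trivial range `α(d,λ) < 1`,
`z(k,d,λ) ≤ ζ(k,d,λ) ≤ Z(k,d,λ)`. -/
theorem zeta_bounds (k d lam : ℕ) (hk : 1 ≤ k) (hd : 1 ≤ d) (hlam : 1 ≤ lam)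
    (hdl : lam ≤ d) (hkl : lam + 1 ≤ k) (hα : alphaVal d lam < 1) :
    zLow k d lam ∈ zetaSet k d lam ∧
    ∀ n ∈ zetaSet k d lam, (n : ℤ) ≤ ZUpp k d lam := by
  have hDpos : (0 : ℝ) < (((d + 1) / 2 : ℕ) : ℝ) := by
    exact_mod_cast (by omega : 0 < (d + 1) / 2)
  have hD : lam ≤ (d + 1) / 2 := by
    rw [alphaVal, div_lt_one hDpos, sub_lt_iff_lt_add] at hα
    have : lam < (d + 1) / 2 + 1 := by exact_mod_cast hα
    omega
  constructor
  · have hne : ((Finset.Icc (lam + 1) (d - lam + 2)).filter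
        (fun j => (j + lam) % 2 = 1)).Nonempty :=
      ⟨lam + 1, Finset.mem_filter.mpr ⟨Finset.mem_Icc.mpr ⟨le_rfl, by omega⟩, by omega⟩⟩
    obtain ⟨j, hj, hsup⟩ := Finset.exists_mem_eq_sup _ hne
      (fun j => ((k - 1) / ((j + lam - 1) / 2)) * j + (k - 1) % ((j + lam - 1) / 2))
    rw [zLow, hsup]
    obtain ⟨hj, hodd⟩ := Finset.mem_filter.mp hj
    obtain ⟨h1, h2⟩ := Finset.mem_Icc.mp hj
    exact block_count_mem_zetaSet hd hlam hdl hk h1 h2 hodd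
  · intro n hn
    obtain ⟨hle, hmul⟩ := mul_le_of_mem_zetaSet hd hlam hdl hD hn
    have hfloor : ((n - (d - lam + 1) : ℕ) : ℤ) ≤
        ⌊(2 - alphaVal d lam) * ((k : ℝ) - 1)⌋ := by
      rw [Int.le_floor, alphaVal]
      have h : (((d + 1) / 2 : ℕ) : ℝ) * ((n - (d - lam + 1) : ℕ) : ℝ) ≤
          (2 * (((d + 1) / 2 : ℕ) : ℝ) + 1 - lam) * ((k : ℝ) - 1) := by
        have h' : ((((d + 1) / 2 * (n - (d - lam + 1)) : ℕ)) : ℝ) ≤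
          (((2 * ((d + 1) / 2) + 1 - lam) * (k - 1) : ℕ) : ℝ) := by exact_mod_cast hmul
        rw [Nat.cast_mul, Nat.cast_mul, Nat.cast_sub (by omega : lam ≤ 2 * ((d + 1) / 2) + 1),
          Nat.cast_sub hk] at h'
        push_cast at h' ⊢
        exact h'
      have h2 : (2 - ((lam : ℝ) - 1) / (((d + 1) / 2 : ℕ) : ℝ)) * ((k : ℝ) - 1) =
          (2 * (((d + 1) / 2 : ℕ) : ℝ) + 1 - lam) * ((k : ℝ) - 1) /
            (((d + 1) / 2 : ℕ) : ℝ) := by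
        field_simp
        ring
      rw [h2, le_div_iff₀ hDpos, mul_comm, Int.cast_natCast]
      exact h
    rw [ZUpp]
    omega
end
end

section
/- For all integers k ≥ 1 and d ≥ 1, m*(k,d,1) = d + 2(k−1). In particular, every set of d+2(k−1) points in ℝ^d has a hyperplane containing at least d of the points such that each of the two open half-spaces determined by it contains at most k−1 of the points, and this hyperplane is transversal to the convex hull of every k-element subset. -/
open Finset

noncomputable section

/-- Points on the moment curve: at most `d` of them lie on a common hyperplane. -/
def momentPt (d : ℕ) (i : ℕ) : Pt d := fun j => (i : ℝ) ^ ((j : ℕ) + 1)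

lemma momentPt_injective {d : ℕ} (hd : 1 ≤ d) : Function.Injective (momentPt d) := by
  intro a b h
  have := congrFun h ⟨0, hd⟩
  simpa [momentPt] using this

lemma linearMap_apply_eq_sum {d : ℕ} (f : Pt d →ₗ[ℝ] ℝ) (x : Pt d) :
    f x = ∑ j, x j * f (Pi.single j 1) := by
  rw [LinearMap.pi_apply_eq_sum_univ f x]
  refine sum_congr rfl fun j _ => ?_
  rw [smul_eq_mul]
  congr 2
  ext i
  simp [Pi.single_apply, eq_comm]

lemma card_momentPt_hyperplane_le {d : ℕ} (f : Pt d →ₗ[ℝ] ℝ) (hf : f ≠ 0) (c : ℝ) (n : ℕ) :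
    (((range n).image (momentPt d)).filter (fun x => f x = c)).card ≤ d := by
  classical
  set p : Polynomial ℝ :=
    ∑ j : Fin d, Polynomial.monomial ((j : ℕ) + 1) (f (Pi.single j 1)) - Polynomial.C c with hp
  have hcoeff (j : Fin d) : p.coeff ((j : ℕ) + 1) = f (Pi.single j 1) := by
    simp [hp, Polynomial.coeff_monomial, Fin.val_inj]
  have hp0 : p ≠ 0 := by
    intro h
    refine hf (LinearMap.ext fun x => ?_)
    rw [linearMap_apply_eq_sum]
    simp [← hcoeff, h]
  have hdeg : p.natDegree ≤ d := by
    refine (Polynomial.natDegree_sub_le _ _).trans (max_le ?_ (by simp))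
    refine Polynomial.natDegree_sum_le_of_forall_le _ _ fun j _ => ?_
    exact (Polynomial.natDegree_monomial_le _).trans j.2
  have heval (i : ℕ) : p.eval (i : ℝ) = f (momentPt d i) - c := by
    rw [linearMap_apply_eq_sum]
    simp [hp, Polynomial.eval_finsetSum, momentPt, mul_comm]
  calc _ ≤ (((range n).filter (fun i => f (momentPt d i) = c)).image (momentPt d)).card := by
        rw [filter_image]
    _ ≤ ((range n).filter (fun i => f (momentPt d i) = c)).card := card_image_le
    _ ≤ p.roots.toFinset.card := by
        refine card_le_card_of_injOn (fun i : ℕ => (i : ℝ)) (fun i hi => ?_)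
          (Nat.cast_injective.injOn)
        simp only [coe_filter, Set.mem_ofPred_eq] at hi
        simp [hp0, heval, hi.2]
    _ ≤ p.roots.card := Multiset.toFinset_card_le _
    _ ≤ d := (Polynomial.card_roots' p).trans hdeg

lemma card_filter_trichotomy {α : Type*} (X : Finset α) (g : α → ℝ) (c : ℝ) :
    X.card = (X.filter (fun x => g x < c)).card + (X.filter (fun x => g x = c)).card
      + (X.filter (fun x => c < g x)).card := by
  classical
  rw [← card_filter_add_card_filter_not (s := X) (fun x => g x < c), add_assoc,
    ← card_filter_add_card_filter_not (s := X.filter (fun x => ¬ g x < c)) (fun x => g x = c),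
    filter_filter, filter_filter]
  congr 3 <;> (ext x; simp only [mem_filter]; grind)

lemma convexHull_inter_hyperplane_nonempty {d k : ℕ} (hk : 1 ≤ k) {X : Finset (Pt d)}
    (f : Pt d →ₗ[ℝ] ℝ) (c : ℝ) (h₁ : (X.filter (fun x => f x < c)).card ≤ k - 1)
    (h₂ : (X.filter (fun x => c < f x)).card ≤ k - 1) {Y : Finset (Pt d)} (hY : Y ⊆ X)
    (hYk : Y.card = k) :
    ((convexHull ℝ (Y : Set (Pt d))) ∩ {x : Pt d | f x = c}).Nonempty := by
  have hge : ∃ y ∈ Y, c ≤ f y := by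
    by_contra! h
    have := card_le_card (fun y hy => mem_filter.2 ⟨hY hy, h y hy⟩ :
      Y ⊆ X.filter (fun x => f x < c))
    omega
  have hle : ∃ y ∈ Y, f y ≤ c := by
    by_contra! h
    have := card_le_card (fun y hy => mem_filter.2 ⟨hY hy, h y hy⟩ :
      Y ⊆ X.filter (fun x => c < f x))
    omega
  obtain ⟨a, ha, hac⟩ := hle
  obtain ⟨b, hb, hbc⟩ := hge
  have hcont : Continuous f := f.continuous_of_finiteDimensional
  obtain ⟨z, hz, hzc⟩ := (convex_convexHull ℝ (Y : Set (Pt d))).isPreconnected.intermediate_value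
    (subset_convexHull ℝ _ (mem_coe.2 ha)) (subset_convexHull ℝ _ (mem_coe.2 hb))
    hcont.continuousOn ⟨hac, hbc⟩
  exact ⟨z, hz, hzc⟩

lemma not_hasCKT_moment {k d n : ℕ} (hk : 1 ≤ k) (hd : 1 ≤ d) (hn : d + 2 * (k - 1) < n) :
    ¬ HasCKT k d 1 ((range n).image (momentPt d)) := by
  rintro ⟨L, hL, ⟨T, -, hTc, hTL⟩, hY⟩
  set X := (range n).image (momentPt d) with hX
  have hXc : X.card = n := by
    rw [hX, card_image_of_injective _ (momentPt_injective hd), card_range]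
  obtain ⟨p, hp⟩ : T.Nonempty := card_pos.1 (by omega)
  have hpL : p ∈ L := hTL hp
  have hlt : L.direction < ⊤ := by
    refine lt_top_iff_ne_top.2 fun h => ?_
    rw [h, finrank_top, Module.finrank_fin_fun] at hL
    omega
  obtain ⟨f, hf, hfL⟩ := Submodule.exists_le_ker_of_lt_top _ hlt
  have hLf : ∀ x ∈ L, f x = f p := fun x hx => by
    have := hfL (AffineSubspace.vsub_mem_direction hx hpL)
    rwa [LinearMap.mem_ker, vsub_eq_sub, map_sub, sub_eq_zero] at this
  have h1 : (X.filter (fun x => f x = f p)).card ≤ d :=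
    card_momentPt_hyperplane_le f hf (f p) n
  have h2 : X.card = (X.filter (fun x => f x < f p)).card +
      (X.filter (fun x => f x = f p)).card + (X.filter (fun x => f p < f x)).card :=
    card_filter_trichotomy X f (f p)
  rcases (by omega : k ≤ (X.filter (fun x => f x < f p)).card ∨
    k ≤ (X.filter (fun x => f p < f x)).card) with h | h
  all_goals
    obtain ⟨Y, hYs, hYk⟩ := exists_subset_card_eq h
    obtain ⟨z, hz, hzL⟩ := hY Y (hYs.trans (filter_subset _ _)) hYk
    have hzp := hLf z hzL
  · have := convexHull_min (fun y hy => (mem_filter.1 (hYs hy)).2)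
      (convex_halfSpace_lt f.isLinear (f p)) hz
    exact (ne_of_lt this) hzp
  · have := convexHull_min (fun y hy => (mem_filter.1 (hYs hy)).2)
      (convex_halfSpace_gt f.isLinear (f p)) hz
    exact (ne_of_gt this) hzp

lemma isOpen_setOf_le_card_filter_pos {E α : Type*} [TopologicalSpace E] (B : Finset α)
    (g : α → E → ℝ) (hg : ∀ x, Continuous (g x)) (k : ℕ) :
    IsOpen {v | k ≤ (B.filter (fun x => 0 < g x v)).card} := by
  rw [isOpen_iff_mem_nhds]
  intro v hv
  have : ∀ᶠ w in nhds v, ∀ x ∈ B.filter (fun x => 0 < g x v), 0 < g x w := by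
    rw [Filter.eventually_all_finset]
    intro x hx
    exact (hg x).continuousAt.eventually (lt_mem_nhds (mem_filter.1 hx).2)
  filter_upwards [this] with w hw
  exact le_trans hv (card_le_card fun x hx => mem_filter.2 ⟨(mem_filter.1 hx).1, hw x hx⟩)

/-- In a space of dimension at least two, an odd number of linear functionals can be evaluated at
a common nonzero vector so that at most half of the values are positive and at most half are
negative. -/
lemma exists_ne_zero_balanced {E α : Type*} [NormedAddCommGroup E] [NormedSpace ℝ E]
    (hE : 1 < Module.rank ℝ E) (B : Finset α) (g : α → E →L[ℝ] ℝ) {k : ℕ} (hk : 1 ≤ k)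
    (hB : B.card = 2 * k - 1) :
    ∃ v : E, v ≠ 0 ∧ (B.filter (fun x => g x v < 0)).card ≤ k - 1 ∧
      (B.filter (fun x => 0 < g x v)).card ≤ k - 1 := by
  classical
  by_contra! hcon
  set P : Set E := {v | k ≤ (B.filter (fun x => 0 < g x v)).card} with hP
  set N : Set E := {v | k ≤ (B.filter (fun x => 0 < (-g x) v)).card} with hN
  have hPo : IsOpen P := isOpen_setOf_le_card_filter_pos B (fun x => g x)
    (fun x => (g x).continuous) k
  have hNo : IsOpen N := isOpen_setOf_le_card_filter_pos B (fun x => -g x)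
    (fun x => (-g x).continuous) k
  have hPN : ∀ v, v ∈ P → v ∈ N → False := by
    intro v h1 h2
    have h3 := card_filter_trichotomy B (fun x => g x v) 0
    simp only [hP, hN, Set.mem_ofPred_eq, neg_apply, neg_pos] at h1 h2
    omega
  have hcover : ∀ v : E, v ≠ 0 → v ∈ P ∪ N := by
    intro v hv
    simp only [hP, hN, Set.mem_union, Set.mem_ofPred_eq, neg_apply, neg_pos]
    by_cases h : (B.filter (fun x => g x v < 0)).card ≤ k - 1
    · have := hcon v hv h
      omega
    · omega
  have hneg : ∀ v, v ∈ P ↔ -v ∈ N := by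
    intro v
    simp [hP, hN]
  have hneg' : ∀ v, v ∈ N ↔ -v ∈ P := by
    intro v
    simp [hP, hN]
  have hconn := isConnected_compl_singleton_of_one_lt_rank hE (0 : E)
  obtain ⟨v, hv⟩ := hconn.nonempty
  have hv' : -v ∈ ({0}ᶜ : Set E) := by simpa using hv
  obtain ⟨hPne, hNne⟩ : (({0}ᶜ : Set E) ∩ P).Nonempty ∧ (({0}ᶜ : Set E) ∩ N).Nonempty := by
    rcases hcover v hv with h | h
    · exact ⟨⟨v, hv, h⟩, ⟨-v, hv', (hneg v).1 h⟩⟩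
    · exact ⟨⟨-v, hv', (hneg' v).1 h⟩, ⟨v, hv, h⟩⟩
  obtain ⟨w, -, hwP, hwN⟩ := hconn.isPreconnected P N hPo hNo (fun u hu => hcover u hu) hPne hNne
  exact hPN w hwP hwN

/-- The evaluation at `x` of the affine functional `y ↦ ∑ j, w j * y j - c` encoded by `(w, c)`. -/
def affineEval {d : ℕ} (x : Pt d) : (Pt d × ℝ) →ₗ[ℝ] ℝ :=
  (Fintype.linearCombination ℝ x).comp (LinearMap.fst ℝ (Pt d) ℝ) - LinearMap.snd ℝ (Pt d) ℝ

lemma affineEval_apply {d : ℕ} (x : Pt d) (v : Pt d × ℝ) :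
    affineEval x v = Fintype.linearCombination ℝ v.1 x - v.2 := by
  simp [affineEval, Fintype.linearCombination_apply, mul_comm]

lemma exists_balanced_hyperplane {k d : ℕ} (hk : 1 ≤ k) (hd : 1 ≤ d) (X : Finset (Pt d))
    (hX : X.card = d + 2 * (k - 1)) :
    ∃ (f : (Pt d) →ₗ[ℝ] ℝ) (c : ℝ), f ≠ 0 ∧
        d ≤ (X.filter (fun x => f x = c)).card ∧
        (X.filter (fun x => f x < c)).card ≤ k - 1 ∧
        (X.filter (fun x => c < f x)).card ≤ k - 1 := by
  obtain ⟨A, hAX, hA⟩ := exists_subset_card_eq (s := X) (n := d - 1) (by omega)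
  have hBc : (X \ A).card = 2 * k - 1 := by
    rw [card_sdiff_of_subset hAX]; omega
  let Φ : (Pt d × ℝ) →ₗ[ℝ] (A → ℝ) := LinearMap.pi fun a => affineEval (a : Pt d)
  have hrank : 1 < Module.finrank ℝ (LinearMap.ker Φ) := by
    have h1 := Φ.finrank_range_add_finrank_ker
    have h2 := Submodule.finrank_le (LinearMap.range Φ)
    simp only [Module.finrank_prod, Module.finrank_self, Module.finrank_fintype_fun_eq_card,
      Fintype.card_coe, Fintype.card_fin] at h1 h2
    omega
  obtain ⟨⟨v, hvΦ⟩, hv0, hneg, hpos⟩ := exists_ne_zero_balanced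
    (E := LinearMap.ker Φ) (Module.lt_rank_of_lt_finrank (by exact_mod_cast hrank)) (X \ A)
    (fun x => LinearMap.toContinuousLinearMap ((affineEval x).comp (LinearMap.ker Φ).subtype))
    hk hBc
  have hvA : ∀ a ∈ A, affineEval a v = 0 := fun a ha => congrFun (LinearMap.mem_ker.1 hvΦ) ⟨a, ha⟩
  have hneg' : (X.filter (fun x => Fintype.linearCombination ℝ v.1 x < v.2)).card ≤ k - 1 := by
    refine le_trans (card_le_card fun x hx => ?_) hneg
    obtain ⟨h1, h2⟩ := mem_filter.1 hx
    rw [← sub_neg, ← affineEval_apply] at h2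
    exact mem_filter.2 ⟨mem_sdiff.2 ⟨h1, fun h => h2.ne (hvA x h)⟩, h2⟩
  have hpos' : (X.filter (fun x => v.2 < Fintype.linearCombination ℝ v.1 x)).card ≤ k - 1 := by
    refine le_trans (card_le_card fun x hx => ?_) hpos
    obtain ⟨h1, h2⟩ := mem_filter.1 hx
    rw [← sub_pos, ← affineEval_apply] at h2
    exact mem_filter.2 ⟨mem_sdiff.2 ⟨h1, fun h => h2.ne' (hvA x h)⟩, h2⟩
  have hd' : d ≤ (X.filter (fun x => Fintype.linearCombination ℝ v.1 x = v.2)).card := by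
    have htri : X.card = (X.filter (fun x => Fintype.linearCombination ℝ v.1 x < v.2)).card +
        (X.filter (fun x => Fintype.linearCombination ℝ v.1 x = v.2)).card +
        (X.filter (fun x => v.2 < Fintype.linearCombination ℝ v.1 x)).card :=
      card_filter_trichotomy X (Fintype.linearCombination ℝ v.1) v.2
    omega
  refine ⟨Fintype.linearCombination ℝ v.1, v.2, fun hf => hv0 ?_, hd', hneg', hpos'⟩
  obtain ⟨x, hx⟩ : (X.filter (fun x => Fintype.linearCombination ℝ v.1 x = v.2)).Nonempty :=
    card_pos.1 (by omega)
  have h2 : v.2 = 0 := by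
    rw [← (mem_filter.1 hx).2, hf, LinearMap.zero_apply]
  have h1 : v.1 = 0 := by
    funext j
    have := congrArg (fun g => g (Pi.single j (1 : ℝ))) hf
    simpa using this
  exact Subtype.ext (Prod.ext h1 h2)

lemma hasCKT_of_hyperplane {k d : ℕ} (hd : 1 ≤ d) {X : Finset (Pt d)} (f : Pt d →ₗ[ℝ] ℝ) (c : ℝ)
    (hf : f ≠ 0) (hc : d ≤ (X.filter (fun x => f x = c)).card)
    (hY : ∀ Y : Finset (Pt d), Y ⊆ X → Y.card = k →
      ((convexHull ℝ (Y : Set (Pt d))) ∩ {x : Pt d | f x = c}).Nonempty) :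
    HasCKT k d 1 X := by
  obtain ⟨p, hp⟩ : (X.filter (fun x => f x = c)).Nonempty := card_pos.1 (by omega)
  have hpc := (mem_filter.1 hp).2
  have hmem : ∀ x, x ∈ AffineSubspace.mk' p (LinearMap.ker f) ↔ f x = c := by
    intro x
    rw [AffineSubspace.mem_mk', LinearMap.mem_ker, vsub_eq_sub, map_sub, sub_eq_zero, hpc]
  refine ⟨AffineSubspace.mk' p (LinearMap.ker f), ?_, ?_, fun Y hYX hYk => ?_⟩
  · have h1 := f.finrank_range_add_finrank_ker
    rw [LinearMap.range_eq_top.2 (LinearMap.surjective hf)] at h1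
    simp only [finrank_top, Module.finrank_self, Module.finrank_fin_fun] at h1
    rw [AffineSubspace.direction_mk']
    exact Nat.eq_sub_of_add_eq' h1
  · obtain ⟨T, hT, hTc⟩ := exists_subset_card_eq hc
    exact ⟨T, hT.trans (filter_subset _ _), by omega,
      fun x hx => (hmem x).2 (mem_filter.1 (hT hx)).2⟩
  · obtain ⟨z, hz, hzc⟩ := hY Y hYX hYk
    exact ⟨z, hz, (hmem z).2 hzc⟩

/-- `m*(k,d,1) = d + 2(k-1)`.  In particular, every set of `d + 2(k-1)`
points in `ℝ^d` has a hyperplane (given by a nonzero linear functional `f` and level `c`)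
containing at least `d` of the points, having at most `k-1` of the points in each of the
two open half-spaces it determines, and transversal to the convex hull of every
`k`-element subset. -/
theorem mStar_lambda_one (k d : ℕ) (hk : 1 ≤ k) (hd : 1 ≤ d) :
    IsGreatest (mStarSet k d 1) (d + 2 * (k - 1)) ∧
    ∀ X : Finset (Pt d), X.card = d + 2 * (k - 1) →
      ∃ (f : (Pt d) →ₗ[ℝ] ℝ) (c : ℝ), f ≠ 0 ∧
        d ≤ (X.filter (fun x => f x = c)).card ∧
        (X.filter (fun x => f x < c)).card ≤ k - 1 ∧
        (X.filter (fun x => c < f x)).card ≤ k - 1 ∧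
        ∀ Y : Finset (Pt d), Y ⊆ X → Y.card = k →
          ((convexHull ℝ (Y : Set (Pt d))) ∩ {x : Pt d | f x = c}).Nonempty := by
  have key : ∀ X : Finset (Pt d), X.card = d + 2 * (k - 1) →
      ∃ (f : (Pt d) →ₗ[ℝ] ℝ) (c : ℝ), f ≠ 0 ∧
        d ≤ (X.filter (fun x => f x = c)).card ∧
        (X.filter (fun x => f x < c)).card ≤ k - 1 ∧
        (X.filter (fun x => c < f x)).card ≤ k - 1 ∧
        ∀ Y : Finset (Pt d), Y ⊆ X → Y.card = k →
          ((convexHull ℝ (Y : Set (Pt d))) ∩ {x : Pt d | f x = c}).Nonempty := by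
    intro X hX
    obtain ⟨f, c, hf, h0, h1, h2⟩ := exists_balanced_hyperplane hk hd X hX
    exact ⟨f, c, hf, h0, h1, h2, fun Y hY hYk =>
      convexHull_inter_hyperplane_nonempty hk f c h1 h2 hY hYk⟩
  refine ⟨⟨⟨by omega, fun X hX => ?_⟩, fun n hn => ?_⟩, key⟩
  · obtain ⟨f, c, hf, h0, -, -, hY⟩ := key X hX
    exact hasCKT_of_hyperplane hd f c hf h0 hY
  · by_contra! hlt
    refine not_hasCKT_moment hk hd hlt (hn.2 _ ?_)
    rw [card_image_of_injective _ (momentPt_injective hd), card_range]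
end
end

section
/- Let d and λ be positive integers with d ≥ λ, and let S and T be two disjoint finite sets of points in ℝ^d such that S ∪ T is in general position, |S| ≥ λ+1 and |T| = d−λ+1. Then conv(S) ∩ aff(T) ≠ ∅ if and only if there exists a subset S' ⊆ S with |S'| = λ+1 such that conv(S') ∩ aff(T) ≠ ∅. -/
open Finset

noncomputable section

/-- A finite set of points of `ℝ^d` is in general position if every subset of at most
`d+1` of its points is affinely independent. -/
def GenPos (d : ℕ) (X : Finset (Pt d)) : Prop :=
  ∀ Y : Finset (Pt d), Y ⊆ X → Y.card ≤ d + 1 →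
    AffineIndependent ℝ (fun p : (Y : Set (Pt d)) => (p : Pt d))

/-- Carathéodory's theorem relative to an affine subspace `A` of codimension `k`: if the convex
hull of a finite set `S` meets `A`, then so does the convex hull of some `k + 1` points of `S`. -/
theorem exists_subset_card_eq_convexHull_inter_nonempty {E : Type*} [AddCommGroup E] [Module ℝ E]
    [FiniteDimensional ℝ E] {A : AffineSubspace ℝ E} {S : Finset E} {k : ℕ}
    (hS : k + 1 ≤ S.card)
    (hk : Module.finrank ℝ E = Module.finrank ℝ A.direction + k)
    (h : (convexHull ℝ (S : Set E) ∩ A).Nonempty) :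
    ∃ S' : Finset E, S' ⊆ S ∧ S'.card = k + 1 ∧ (convexHull ℝ (S' : Set E) ∩ A).Nonempty := by
  classical
  obtain ⟨t, htS, htA⟩ := h
  let π := A.direction.mkQ
  have hquot : Module.finrank ℝ (E ⧸ A.direction) = k := by
    have := A.direction.finrank_quotient_add_finrank
    omega
  have hπt : π t ∈ convexHull ℝ (π '' S) := by
    rw [← LinearMap.image_convexHull]
    exact Set.mem_image_of_mem _ htS
  rw [convexHull_eq_union] at hπt
  simp only [Set.mem_iUnion] at hπt
  obtain ⟨U, hUS, hU, htU⟩ := hπt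
  have hUcard : U.card ≤ k + 1 := by
    have := hU.card_le_finrank_succ
    rw [Fintype.card_coe] at this
    have := Submodule.finrank_le (vectorSpan ℝ (Set.range ((↑) : U → E ⧸ A.direction)))
    omega
  obtain ⟨R, hRS, rfl, hRcard⟩ : ∃ R ⊆ S, R.image π = U ∧ R.card = U.card := by
    obtain ⟨R, hRS, hinj, hRU⟩ :=
      Finset.exists_subset_injOn_image_eq_of_surjOn (f := π) (S : Set E) U hUS
    exact ⟨R, Finset.coe_subset.1 hRS, hRU, by rw [← hRU, Finset.card_image_of_injOn hinj]⟩
  obtain ⟨S', hRS', hS'S, hS'⟩ :=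
    Finset.exists_subsuperset_card_eq hRS (hRcard.trans_le hUcard) hS
  refine ⟨S', hS'S, hS', ?_⟩
  have hπt : π t ∈ π '' convexHull ℝ (S' : Set E) := by
    rw [LinearMap.image_convexHull]
    refine convexHull_mono ?_ htU
    rw [Finset.coe_image]
    exact Set.image_mono (Finset.coe_subset.2 hRS')
  obtain ⟨x, hx, hxt⟩ := hπt
  refine ⟨x, hx, ?_⟩
  have hmem : x - t ∈ A.direction := (Submodule.Quotient.eq _).1 hxt
  simpa using AffineSubspace.vadd_mem_of_mem_direction hmem htA

/-- for disjoint sets `S`, `T` with `S ∪ T` in general position,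
`|S| ≥ λ+1` and `|T| = d-λ+1`, `conv(S)` meets `aff(T)` iff `conv(S')` meets `aff(T)`
for some `(λ+1)`-element subset `S' ⊆ S`. -/
theorem conv_aff_iff_subset (d lam : ℕ) (hd : 1 ≤ d) (hlam : 1 ≤ lam) (hdl : lam ≤ d)
    (S T : Finset (Pt d)) (hST : Disjoint S T) (hgp : GenPos d (S ∪ T))
    (hS : lam + 1 ≤ S.card) (hT : T.card = d - lam + 1) :
    ((convexHull ℝ (S : Set (Pt d))) ∩
        ((affineSpan ℝ (T : Set (Pt d)) : AffineSubspace ℝ (Pt d)) : Set (Pt d))).Nonempty ↔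
    ∃ S' : Finset (Pt d), S' ⊆ S ∧ S'.card = lam + 1 ∧
      ((convexHull ℝ (S' : Set (Pt d))) ∩
        ((affineSpan ℝ (T : Set (Pt d)) : AffineSubspace ℝ (Pt d)) : Set (Pt d))).Nonempty := by
  constructor
  · have hTi := hgp T subset_union_right (by omega)
    have hrange : Set.range (fun p : (T : Set (Pt d)) => (p : Pt d)) = T := Subtype.range_coe
    have hfin : Module.finrank ℝ (affineSpan ℝ (T : Set (Pt d))).direction = d - lam := by
      rw [direction_affineSpan, ← hrange]
      exact hTi.finrank_vectorSpan (by simpa using hT)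
    refine exists_subset_card_eq_convexHull_inter_nonempty hS ?_
    rw [hfin, Module.finrank_fin_fun]
    omega
  · rintro ⟨S', hS', -, h⟩
    exact h.mono (Set.inter_subset_inter_left _ (convexHull_mono (Finset.coe_subset.2 hS')))
end
end

section
/- Let S and T be two disjoint and non-empty finite sets of points in ℝ^d such that |S| + |T| = d+2 and S ∪ T is in general position. Then conv(S) ∩ aff(T) ≠ ∅ if and only if all the points of S belong to the same part of the Radon partition of S ∪ T. -/
open Finset

noncomputable section

/-- A point lies in the affine span of a finite set iff it is a combination of the points of the
set whose weights sum to one. -/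
lemma mem_affineSpan_finset_iff {E : Type*} [AddCommGroup E] [Module ℝ E] {T : Finset E} {x : E} :
    x ∈ affineSpan ℝ (T : Set E) ↔
      ∃ w : E → ℝ, ∑ y ∈ T, w y = 1 ∧ ∑ y ∈ T, w y • y = x := by
  classical
  constructor
  · intro hx
    rw [← Set.image_id (T : Set E)] at hx
    obtain ⟨F, w, hF, hw, rfl⟩ := eq_affineCombination_of_mem_affineSpan_image hx
    have hFT : T ∩ F = F := Finset.inter_eq_right.2 (by exact_mod_cast hF)
    refine ⟨fun y => if y ∈ F then w y else 0, ?_, ?_⟩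
    · rw [Finset.sum_ite_mem, hFT, hw]
    · simp only [ite_smul, zero_smul]
      rw [Finset.sum_ite_mem, hFT, F.affineCombination_eq_linear_combination _ _ hw]
      rfl
  · rintro ⟨w, hw, rfl⟩
    have hw' : ∑ y : T, w y = 1 := by rw [Finset.sum_coe_sort T w, hw]
    have h := affineCombination_mem_affineSpan hw' (fun y : T => (y : E))
    rw [Finset.affineCombination_eq_linear_combination _ _ _ hw',
      Finset.sum_coe_sort T (fun y => w y • y)] at h
    simpa using h

/-- Among `d + 2` points in general position, a nontrivial affine dependence has no vanishing
weight. -/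
lemma GenPos.weight_ne_zero {d : ℕ} {X : Finset (Pt d)} (hX : GenPos d X)
    (hcard : X.card = d + 2) {w : Pt d → ℝ} (hw : ∑ p ∈ X, w p = 0)
    (hwp : ∑ p ∈ X, w p • p = 0) (hne : ∃ p ∈ X, w p ≠ 0) : ∀ p ∈ X, w p ≠ 0 := by
  classical
  intro p hp hp0
  obtain ⟨q, hq, hq0⟩ := hne
  have hind := hX (X.erase p) (Finset.erase_subset _ _)
    (by rw [Finset.card_erase_of_mem hp]; omega)
  rw [affineIndependent_iff] at hind
  have hqp : q ∈ X.erase p := Finset.mem_erase.2 ⟨fun h => hq0 (h ▸ hp0), hq⟩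
  refine hq0 (hind (X.erase p).attach (fun y => w y) ?_ ?_ ⟨q, hqp⟩ (Finset.mem_attach _ _))
  · exact (Finset.sum_attach (X.erase p) w).trans ((Finset.sum_erase X hp0).trans hw)
  · exact (Finset.sum_attach (X.erase p) fun y => w y • y).trans
      ((Finset.sum_erase X (by rw [hp0, zero_smul])).trans hwp)

/-- A nontrivial affine dependence splits its support into two sets with intersecting hulls. -/
lemma convexHull_inter_convexHull_of_dependence {E : Type*} [AddCommGroup E] [Module ℝ E]
    {X : Finset E} {w : E → ℝ} (hw : ∑ p ∈ X, w p = 0) (hwp : ∑ p ∈ X, w p • p = 0)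
    (hpos : ∃ p ∈ X, 0 < w p) :
    (convexHull ℝ ((X.filter fun p => 0 < w p : Finset E) : Set E) ∩
      convexHull ℝ ((X.filter fun p => ¬ 0 < w p : Finset E) : Set E)).Nonempty := by
  obtain ⟨q, hq, hq0⟩ := hpos
  have hc : 0 < ∑ p ∈ X with 0 < w p, w p :=
    Finset.sum_pos (fun p hp => (Finset.mem_filter.1 hp).2) ⟨q, Finset.mem_filter.2 ⟨hq, hq0⟩⟩
  rw [← Finset.sum_filter_add_sum_filter_not X fun p => 0 < w p] at hw hwp
  set c := ∑ p ∈ X with 0 < w p, w p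
  refine ⟨c⁻¹ • ∑ p ∈ X with 0 < w p, w p • p, Finset.mem_convexHull'.2
    ⟨fun p => c⁻¹ * w p, fun p hp => ?_, ?_, ?_⟩, Finset.mem_convexHull'.2
    ⟨fun p => c⁻¹ * -w p, fun p hp => ?_, ?_, ?_⟩⟩
  · have := (Finset.mem_filter.1 hp).2
    positivity
  · rw [← Finset.mul_sum, inv_mul_cancel₀ hc.ne']
  · simp only [mul_smul, Finset.smul_sum]
  · have := (Finset.mem_filter.1 hp).2
    exact mul_nonneg (inv_nonneg.2 hc.le) (by linarith)
  · rw [← Finset.mul_sum, Finset.sum_neg_distrib, ← eq_neg_of_add_eq_zero_left hw,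
      inv_mul_cancel₀ hc.ne']
  · simp only [mul_smul, ← Finset.smul_sum, neg_smul, Finset.sum_neg_distrib]
    rw [← eq_neg_of_add_eq_zero_left hwp]

/-- In an affine dependence on `S ∪ T` that is positive on `S`, the set `S` can be rescaled to a
convex combination lying in the affine span of `T`. -/
lemma convexHull_inter_affineSpan_of_dependence {E : Type*} [AddCommGroup E] [Module ℝ E]
    [DecidableEq E] {S T : Finset E} (hST : Disjoint S T) (hS : S.Nonempty) {w : E → ℝ}
    (hw : ∑ p ∈ S ∪ T, w p = 0) (hwp : ∑ p ∈ S ∪ T, w p • p = 0) (hpos : ∀ p ∈ S, 0 < w p) :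
    (convexHull ℝ (S : Set E) ∩ (affineSpan ℝ (T : Set E) : Set E)).Nonempty := by
  have hc : 0 < ∑ p ∈ S, w p := Finset.sum_pos hpos hS
  rw [Finset.sum_union hST] at hw hwp
  set c := ∑ p ∈ S, w p
  refine ⟨c⁻¹ • ∑ p ∈ S, w p • p, Finset.mem_convexHull'.2
    ⟨fun p => c⁻¹ * w p, fun p hp => ?_, ?_, ?_⟩, mem_affineSpan_finset_iff.2
    ⟨fun p => c⁻¹ * -w p, ?_, ?_⟩⟩
  · have := hpos p hp
    positivity
  · rw [← Finset.mul_sum, inv_mul_cancel₀ hc.ne']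
  · simp only [mul_smul, Finset.smul_sum]
  · rw [← Finset.mul_sum, Finset.sum_neg_distrib, ← eq_neg_of_add_eq_zero_left hw,
      inv_mul_cancel₀ hc.ne']
  · simp only [mul_smul, ← Finset.smul_sum, neg_smul, Finset.sum_neg_distrib]
    rw [← eq_neg_of_add_eq_zero_left hwp]

/-- Two combinations of disjoint sets with total weight one and the same value give an affine
dependence on the union. -/
lemma dependence_of_combinations_eq {E : Type*} [AddCommGroup E] [Module ℝ E] [DecidableEq E]
    {A B : Finset E} (hAB : Disjoint A B) {a b : E → ℝ} (ha : ∑ p ∈ A, a p = 1)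
    (hb : ∑ p ∈ B, b p = 1) (hab : ∑ p ∈ A, a p • p = ∑ p ∈ B, b p • p) :
    ∃ w : E → ℝ, ∑ p ∈ A ∪ B, w p = 0 ∧ ∑ p ∈ A ∪ B, w p • p = 0 ∧
      (∀ p ∈ A, w p = a p) ∧ ∃ p ∈ A ∪ B, w p ≠ 0 := by
  have hA : ∀ p ∈ A, (if p ∈ A then a p else -b p) = a p := fun p hp => if_pos hp
  have hB : ∀ p ∈ B, (if p ∈ A then a p else -b p) = -b p :=
    fun p hp => if_neg (Finset.disjoint_right.1 hAB hp)
  refine ⟨fun p => if p ∈ A then a p else -b p, ?_, ?_, hA, ?_⟩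
  · rw [Finset.sum_union hAB, Finset.sum_congr rfl hA, Finset.sum_congr rfl hB,
      Finset.sum_neg_distrib, ha, hb, add_neg_cancel]
  · rw [Finset.sum_union hAB,
      Finset.sum_congr (s₁ := A) rfl fun p hp => congrArg (· • p) (hA p hp),
      Finset.sum_congr (s₁ := B) rfl fun p hp => congrArg (· • p) (hB p hp)]
    simp only [neg_smul, Finset.sum_neg_distrib, hab, add_neg_cancel]
  · obtain ⟨p, hp, hp0⟩ := Finset.exists_ne_zero_of_sum_ne_zero (ha.trans_ne one_ne_zero)
    exact ⟨p, Finset.mem_union_left _ hp, by simpa only [hA p hp] using hp0⟩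

/-- If the hulls of two disjoint sets covering `S ∪ T` meet and `S` lies in one of them, then the
hull of `S` meets the affine span of `T`. -/
lemma GenPos.convexHull_inter_affineSpan_of_subset {d : ℕ} {S T A B : Finset (Pt d)}
    (hST : Disjoint S T) (hS : S.Nonempty) (hcard : S.card + T.card = d + 2)
    (hgp : GenPos d (S ∪ T)) (hAB : A ∪ B = S ∪ T) (hdisj : Disjoint A B)
    (hne : (convexHull ℝ (A : Set (Pt d)) ∩ convexHull ℝ (B : Set (Pt d))).Nonempty)
    (hSA : S ⊆ A) :
    (convexHull ℝ (S : Set (Pt d)) ∩ (affineSpan ℝ (T : Set (Pt d)) : Set (Pt d))).Nonempty := by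
  obtain ⟨x, hxA, hxB⟩ := hne
  obtain ⟨a, ha0, ha, rfl⟩ := Finset.mem_convexHull'.1 hxA
  obtain ⟨b, -, hb, hab⟩ := Finset.mem_convexHull'.1 hxB
  obtain ⟨w, hw, hwp, hwa, hw0⟩ := dependence_of_combinations_eq hdisj ha hb hab.symm
  rw [hAB] at hw hwp hw0
  have hnz := hgp.weight_ne_zero (by rw [Finset.card_union_of_disjoint hST, hcard]) hw hwp hw0
  refine convexHull_inter_affineSpan_of_dependence hST hS hw hwp fun p hp => ?_
  refine lt_of_le_of_ne ?_ (hnz p (Finset.mem_union_left _ hp)).symm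
  rw [hwa p (hSA hp)]
  exact ha0 p (hSA hp)

/-- for disjoint nonempty `S`, `T` with `|S| + |T| = d+2` and `S ∪ T` in
general position, `conv(S)` meets `aff(T)` iff all points of `S` lie in the same part of
the Radon partition of `S ∪ T` (which is unique under general position, so we quantify
existentially over Radon partitions). -/
theorem conv_aff_iff_radon (d : ℕ) (hd : 1 ≤ d) (S T : Finset (Pt d))
    (hST : Disjoint S T) (hSn : S.Nonempty) (hTn : T.Nonempty)
    (hcard : S.card + T.card = d + 2) (hgp : GenPos d (S ∪ T)) :
    ((convexHull ℝ (S : Set (Pt d))) ∩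
        ((affineSpan ℝ (T : Set (Pt d)) : AffineSubspace ℝ (Pt d)) : Set (Pt d))).Nonempty ↔
    ∃ A B : Finset (Pt d), A ∪ B = S ∪ T ∧ Disjoint A B ∧ A.Nonempty ∧ B.Nonempty ∧
      ((convexHull ℝ (A : Set (Pt d))) ∩ (convexHull ℝ (B : Set (Pt d)))).Nonempty ∧
      (S ⊆ A ∨ S ⊆ B) := by
  constructor
  · rintro ⟨x, hxS, hxT⟩
    obtain ⟨a, ha0, ha, rfl⟩ := Finset.mem_convexHull'.1 hxS
    obtain ⟨b, hb, hab⟩ := mem_affineSpan_finset_iff.1 hxT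
    obtain ⟨w, hw, hwp, hwa, hw0⟩ := dependence_of_combinations_eq hST ha hb hab.symm
    have hnz := hgp.weight_ne_zero (by rw [Finset.card_union_of_disjoint hST, hcard]) hw hwp hw0
    have hpos : ∀ p ∈ S, 0 < w p := fun p hp =>
      lt_of_le_of_ne (by rw [hwa p hp]; exact ha0 p hp) (hnz p (Finset.mem_union_left _ hp)).symm
    obtain ⟨q, hq⟩ := hSn
    have hne := convexHull_inter_convexHull_of_dependence hw hwp
      ⟨q, Finset.mem_union_left _ hq, hpos q hq⟩
    refine ⟨_, _, Finset.filter_union_filter_not_eq _ _, Finset.disjoint_filter_filter_not _ _ _,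
      ?_, ?_, hne, Or.inl fun p hp => Finset.mem_filter.2 ⟨Finset.mem_union_left _ hp, hpos p hp⟩⟩
    · exact Finset.coe_nonempty.1 (convexHull_nonempty_iff.1 hne.left)
    · exact Finset.coe_nonempty.1 (convexHull_nonempty_iff.1 hne.right)
  · rintro ⟨A, B, hAB, hdisj, -, -, hne, hSA | hSB⟩
    · exact hgp.convexHull_inter_affineSpan_of_subset hST hSn hcard hAB hdisj hne hSA
    · exact hgp.convexHull_inter_affineSpan_of_subset hST hSn hcard
        (by rw [Finset.union_comm, hAB]) hdisj.symm (by rwa [Set.inter_comm]) hSB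
end
end

section
/- Let X be any set of d+2 distinct points in ℝ^d (not necessarily in general position) and let t be an integer with ⌊(d+2)/2⌋ ≤ t ≤ d+1. Then X can be partitioned into two disjoint sets S and T such that |T| = t and conv(S) ∩ aff(T) ≠ ∅. -/
open Finset

noncomputable section

/-- An affine dependence whose coefficients are nonnegative on `S`, and positive somewhere on `S`,
yields a common point of `conv S` and the affine span of the remaining points. -/
lemma convexHull_inter_affineSpan_nonempty {E : Type*} [AddCommGroup E] [Module ℝ E]
    {S T : Finset E} {f : E → ℝ} (hsum : ∑ x ∈ S, f x + ∑ x ∈ T, f x = 0)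
    (hsmul : ∑ x ∈ S, f x • x + ∑ x ∈ T, f x • x = 0)
    (hnonneg : ∀ x ∈ S, 0 ≤ f x) (hpos : ∃ x ∈ S, 0 < f x) :
    ((convexHull ℝ (S : Set E)) ∩
      ((affineSpan ℝ (T : Set E) : AffineSubspace ℝ E) : Set E)).Nonempty := by
  have hS : 0 < ∑ x ∈ S, f x := Finset.sum_pos' hnonneg hpos
  have hT : ∑ x ∈ T, f x = -∑ x ∈ S, f x := by linarith
  have hTsmul : ∑ x ∈ T, f x • x = -∑ x ∈ S, f x • x := eq_neg_of_add_eq_zero_right hsmul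
  refine ⟨S.centerMass f id, S.centerMass_mem_convexHull hnonneg hS fun x hx => hx, ?_⟩
  have hw : ∑ x ∈ T, (∑ y ∈ T, f y)⁻¹ * f x = 1 := by
    rw [← Finset.mul_sum, inv_mul_cancel₀]
    rw [hT]
    exact neg_ne_zero.mpr hS.ne'
  have hmem := affineCombination_mem_affineSpan_image hw (s' := (T : Set E))
    (fun x hx hx' => absurd hx hx') id
  rw [Set.image_id, Finset.affineCombination_eq_linear_combination _ _ _ hw] at hmem
  rw [SetLike.mem_coe]
  convert hmem using 1
  simp only [Finset.centerMass, id, mul_smul, ← Finset.smul_sum]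
  rw [hTsmul, hT, inv_neg, neg_smul_neg]

/-- A finite set carrying a nontrivial affine dependence with at least `s` nonnegative
coefficients contains a set of `s` points whose convex hull meets the affine span of the rest. -/
lemma exists_subset_convexHull_inter_affineSpan_nonempty {E : Type*} [AddCommGroup E]
    [Module ℝ E] [DecidableEq E] {X : Finset E} {f : E → ℝ} {s : ℕ}
    (hsum : ∑ x ∈ X, f x = 0) (hsmul : ∑ x ∈ X, f x • x = 0) (hne : ∃ x ∈ X, f x ≠ 0)
    (hs : 1 ≤ s) (hcard : s ≤ (X.filter fun x => 0 ≤ f x).card) :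
    ∃ S ⊆ X, S.card = s ∧ ((convexHull ℝ (S : Set E)) ∩
      ((affineSpan ℝ ((X \ S : Finset E) : Set E) : AffineSubspace ℝ E) : Set E)).Nonempty := by
  obtain ⟨p, hpX, hp⟩ := Finset.exists_pos_of_sum_zero_of_exists_nonzero f hsum hne
  obtain ⟨S, hpS, hSX, hScard⟩ := Finset.exists_subsuperset_card_eq
    (s := {p}) (t := X.filter fun x => 0 ≤ f x) (n := s)
    (by simp [hpX, hp.le]) (by simpa using hs) hcard
  have hSsub : S ⊆ X := hSX.trans (Finset.filter_subset _ _)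
  refine ⟨S, hSsub, hScard, convexHull_inter_affineSpan_nonempty (f := f) ?_ ?_
    (fun x hx => (Finset.mem_filter.mp (hSX hx)).2) ⟨p, hpS (Finset.mem_singleton_self p), hp⟩⟩
  · rw [add_comm, Finset.sum_sdiff hSsub, hsum]
  · rw [add_comm, Finset.sum_sdiff hSsub, hsmul]

/-- any set `X` of `d+2` distinct points in `ℝ^d` can be partitioned into
disjoint sets `S` and `T` with `|T| = t` (`⌊(d+2)/2⌋ ≤ t ≤ d+1`) such that `conv(S)`
meets `aff(T)`. -/
theorem partition_conv_aff (d t : ℕ) (hd : 1 ≤ d) (X : Finset (Pt d))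
    (hX : X.card = d + 2) (ht1 : (d + 2) / 2 ≤ t) (ht2 : t ≤ d + 1) :
    ∃ S T : Finset (Pt d), Disjoint S T ∧ S ∪ T = X ∧ T.card = t ∧
      ((convexHull ℝ (S : Set (Pt d))) ∩
        ((affineSpan ℝ (T : Set (Pt d)) : AffineSubspace ℝ (Pt d)) : Set (Pt d))).Nonempty := by
  suffices h : ∃ S ⊆ X, S.card = d + 2 - t ∧ ((convexHull ℝ (S : Set (Pt d))) ∩
      ((affineSpan ℝ ((X \ S : Finset (Pt d)) : Set (Pt d)) :
        AffineSubspace ℝ (Pt d)) : Set (Pt d))).Nonempty by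
    obtain ⟨S, hS, hcard, hne⟩ := h
    refine ⟨S, X \ S, Finset.disjoint_sdiff, Finset.union_sdiff_of_subset hS, ?_, hne⟩
    rw [Finset.card_sdiff_of_subset hS, hcard, hX]
    omega
  obtain ⟨f, hsmul, hsum, hne⟩ :=
    Module.exists_nontrivial_relation_sum_zero_of_finrank_succ_lt_card (R := ℝ) (t := X)
      (by rw [hX, Module.finrank_fin_fun]; omega)
  have hcover : X.card ≤ (X.filter fun x => 0 ≤ f x).card + (X.filter fun x => 0 ≤ -f x).card := by
    refine le_trans (Finset.card_le_card fun x hx => ?_) (Finset.card_union_le _ _)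
    rcases le_total 0 (f x) with h | h <;> simp [hx, h]
  by_cases hc : d + 2 - t ≤ (X.filter fun x => 0 ≤ f x).card
  · exact exists_subset_convexHull_inter_affineSpan_nonempty hsum hsmul hne (by omega) hc
  · refine exists_subset_convexHull_inter_affineSpan_nonempty (f := fun x => -f x)
      ?_ ?_ ?_ (by omega) (by omega)
    · simp [hsum]
    · simp [hsmul]
    · simpa using hne
end
end

section
/- Let ℓ ≥ 0 and k ≥ 1 be integers, and let D(k,ℓ) be the maximum n (possibly infinite) such that every k-element subset of {1,…,n} contains a subset S with OD(S) ≥ ℓ. Then: D(k,0) is infinite (every n works); if k ≥ ℓ ≥ 1 then D(k,ℓ) = 2k−ℓ−1, i.e., every k-element subset of {1,…,2k−ℓ−1} contains a subset S with OD(S) ≥ ℓ, while {1,…,2k−ℓ} has a k-element subset all of whose subsets S satisfy OD(S) ≤ ℓ−1; and if ℓ ≥ k then D(k,ℓ) = k−1, i.e., every k-element subset of {1,…,n} with n ≥ k has all subsets S with OD(S) ≤ k−1 < ℓ. -/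
open Finset

noncomputable section

/-- `OD S` is the number of odd integers among the consecutive differences
`x₂-x₁, x₃-x₂, …, x_r-x_{r-1}` of the increasingly-ordered elements `x₁ < x₂ < … < x_r`
of the finite set `S` of naturals. -/
def OD (S : Finset ℕ) : ℕ :=
  (((S.sort (· ≤ ·)).zip (S.sort (· ≤ ·)).tail).filter
    (fun p => (p.2 - p.1) % 2 = 1)).length

/-- The number of odd consecutive differences of a list of naturals. -/
def oddGaps (L : List ℕ) : ℕ :=
  ((L.zip L.tail).filter (fun p => (p.2 - p.1) % 2 = 1)).length

lemma oddGaps_singleton (a : ℕ) : oddGaps [a] = 0 := by simp [oddGaps]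

lemma oddGaps_cons_cons (a b : ℕ) (t : List ℕ) :
    oddGaps (a :: b :: t) = oddGaps (b :: t) + if (b - a) % 2 = 1 then 1 else 0 := by
  by_cases h : (b - a) % 2 = 1 <;> simp [oddGaps, h]

lemma OD_eq_oddGaps_sort (S : Finset ℕ) : OD S = oddGaps (S.sort (· ≤ ·)) := rfl

lemma oddGaps_le_length_sub_one (L : List ℕ) : oddGaps L ≤ L.length - 1 := by
  have h : oddGaps L ≤ (L.zip L.tail).length := List.length_filter_le _ _
  simp only [List.length_zip, List.length_tail] at h
  omega

/-- In an increasing list, every even gap has size at least two. -/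
lemma add_two_mul_length_le_add_oddGaps (N : ℕ) (t : List ℕ) :
    ∀ a, (a :: t).Pairwise (· < ·) → (∀ x ∈ a :: t, x ≤ N) →
      a + 2 * t.length ≤ N + oddGaps (a :: t) := by
  induction t with
  | nil => intro a _ hN; simpa [oddGaps_singleton] using hN a
  | cons b t ih =>
    intro a hs hN
    have hab : a < b := (List.pairwise_cons.1 hs).1 b (by simp)
    have := ih b (List.pairwise_cons.1 hs).2 fun x hx => hN x (List.mem_cons_of_mem _ hx)
    rw [oddGaps_cons_cons, List.length_cons]
    split_ifs <;> omega

/-- A function that is monotone along an increasing list, and strictly so across odd gaps,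
bounds the number of odd gaps. -/
lemma add_oddGaps_le_of_potential (f : ℕ → ℕ) (M : ℕ) (t : List ℕ) :
    ∀ a, (a :: t).Pairwise (fun x y => f x + (if (y - x) % 2 = 1 then 1 else 0) ≤ f y) →
      (∀ x ∈ a :: t, f x ≤ M) → f a + oddGaps (a :: t) ≤ M := by
  induction t with
  | nil => intro a _ hM; simpa [oddGaps_singleton] using hM a
  | cons b t ih =>
    intro a hs hM
    have hab := (List.pairwise_cons.1 hs).1 b (by simp)
    have := ih b (List.pairwise_cons.1 hs).2 fun x hx => hM x (List.mem_cons_of_mem _ hx)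
    rw [oddGaps_cons_cons]
    omega

lemma OD_le_card_sub_one (S : Finset ℕ) : OD S ≤ #S - 1 := by
  simpa [OD_eq_oddGaps_sort] using oddGaps_le_length_sub_one (S.sort (· ≤ ·))

lemma two_mul_card_le_add_OD {K : Finset ℕ} {N : ℕ} (hK : K ⊆ Icc 1 N) (hne : K.Nonempty) :
    2 * #K ≤ N + 1 + OD K := by
  have hs := K.sortedLT_sort.pairwise
  have hm : ∀ x ∈ K.sort (· ≤ ·), 1 ≤ x ∧ x ≤ N := fun x hx =>
    mem_Icc.1 (hK ((mem_sort (· ≤ ·)).1 hx))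
  have hc : (K.sort (· ≤ ·)).length = #K := length_sort _
  rw [OD_eq_oddGaps_sort]
  have hpos := hne.card_pos
  cases h : K.sort (· ≤ ·) with
  | nil => simp [h] at hc; omega
  | cons a t =>
    rw [h] at hs hm hc
    have := add_two_mul_length_le_add_oddGaps N t a hs fun x hx => (hm x hx).2
    have := (hm a (by simp)).1
    rw [List.length_cons] at hc
    omega

lemma OD_le_sub_one_of_even_gaps_above {S : Finset ℕ} {l : ℕ} (hl : 1 ≤ l)
    (hS : ∀ x ∈ S, 1 ≤ x ∧ (l < x → x % 2 = l % 2)) : OD S ≤ l - 1 := by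
  have hs := S.sortedLT_sort.pairwise
  have hm : ∀ x ∈ S.sort (· ≤ ·), 1 ≤ x ∧ (l < x → x % 2 = l % 2) := fun x hx =>
    hS x ((mem_sort (· ≤ ·)).1 hx)
  rw [OD_eq_oddGaps_sort]
  cases h : S.sort (· ≤ ·) with
  | nil => simp [oddGaps]
  | cons a t =>
    rw [h] at hs hm
    have hp := add_oddGaps_le_of_potential (min · l) l t a
      (hs.imp_of_mem fun {x y} hx hy hxy => by
        have h1 := hm x hx
        have h2 := hm y hy
        split_ifs <;> omega) (fun x _ => min_le_right x l)
    have := (hm a (by simp)).1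
    omega

/-- the value of `D(k,ℓ)`, the maximum `n` such that every `k`-element
subset of `{1,…,n}` contains a subset `S` with `OD(S) ≥ ℓ`:
`D(k,0)` is infinite; `D(k,ℓ) = 2k-ℓ-1` when `k ≥ ℓ ≥ 1`; and `D(k,ℓ) = k-1` when
`ℓ ≥ k`. -/
theorem OD_extremal (k l : ℕ) (hk : 1 ≤ k) :
    (l = 0 → ∀ n : ℕ, ∀ K : Finset ℕ, K ⊆ Finset.Icc 1 n → K.card = k →
      ∃ S : Finset ℕ, S ⊆ K ∧ l ≤ OD S) ∧
    (1 ≤ l → l ≤ k →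
      (∀ K : Finset ℕ, K ⊆ Finset.Icc 1 (2 * k - l - 1) → K.card = k →
        ∃ S : Finset ℕ, S ⊆ K ∧ l ≤ OD S) ∧
      (∃ K : Finset ℕ, K ⊆ Finset.Icc 1 (2 * k - l) ∧ K.card = k ∧
        ∀ S : Finset ℕ, S ⊆ K → OD S ≤ l - 1)) ∧
    (k ≤ l → ∀ n : ℕ, k ≤ n → ∀ K : Finset ℕ, K ⊆ Finset.Icc 1 n → K.card = k →
      ∀ S : Finset ℕ, S ⊆ K → OD S ≤ k - 1) := by
  refine ⟨?_, ?_, ?_⟩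
  · rintro rfl n K - -
    exact ⟨∅, empty_subset K, Nat.zero_le _⟩
  · intro hl hlk
    constructor
    · intro K hK hc
      refine ⟨K, Subset.rfl, ?_⟩
      have := two_mul_card_le_add_OD hK (card_pos.1 (by omega))
      omega
    · have hinj : Function.Injective fun i : ℕ => max i (2 * i - l) := by
        intro i j h
        dsimp only at h
        omega
      refine ⟨(Icc 1 k).image fun i => max i (2 * i - l), ?_, ?_, ?_⟩
      · intro x hx
        obtain ⟨i, hi, rfl⟩ := mem_image.1 hx
        rw [mem_Icc] at hi ⊢
        omega
      · simp [card_image_of_injective _ hinj]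
      · intro S hS
        refine OD_le_sub_one_of_even_gaps_above hl fun x hx => ?_
        obtain ⟨i, hi, rfl⟩ := mem_image.1 (hS hx)
        rw [mem_Icc] at hi
        omega
  · intro _ n _ K _ hc S hS
    have := OD_le_card_sub_one S
    have := card_le_card hS
    omega
end
end
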